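/- arXiv:1610.03044 — 2 statements merged into one kernel-verified Lean document; each statement's English description precedes it below -/
import Mathlib

section
/- For α = 0, the second Painlevé equation y''(s) = s·y(s) + 2·y(s)³ has a minimal solution y with y(s) > 0 for all s, y'(s) < 0 for all s, y(s) → 0 as s → +∞ (indeed y(s) ≤ y(0)·e^{−(2/3)s^{3/2}} for all s ≥ 0), and y(s) − √(|s|/2) → 0 as s → −∞. Moreover this is the only nonnegative minimal solution that is bounded on a neighborhood of +∞. -/
open MeasureTheory Filter Topology Set


/-- The Painlevé II energy of `u` over a set `I`. -/
noncomputable def EPII (α : ℝ) (u : ℝ → ℝ) (I : Set ℝ) : ℝ :=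
  ∫ s in I, ((1:ℝ)/2 * (deriv u s) ^ 2 + 1/2 * s * (u s) ^ 2 + 1/2 * (u s) ^ 4 + α * u s)

/-- A (classical) solution of the second Painlevé equation `y'' = s y + 2 y³ + α`. -/
def PainleveSol (α : ℝ) (y : ℝ → ℝ) : Prop :=
  ContDiff ℝ 2 y ∧ ∀ s : ℝ, deriv (deriv y) s = s * y s + 2 * (y s) ^ 3 + α

/-- A minimal solution of the second Painlevé equation: it minimizes `E_PII` with respect to
smooth compactly supported perturbations. -/
def MinimalSol (α : ℝ) (y : ℝ → ℝ) : Prop :=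
  PainleveSol α y ∧ ∀ φ : ℝ → ℝ, ContDiff ℝ (⊤ : ℕ∞) φ → HasCompactSupport φ →
    EPII α y (tsupport φ) ≤ EPII α (fun s => y s + φ s) (tsupport φ)


/-! ### Second derivative test and a first-order description of solutions -/

theorem second_deriv_nonpos_of_isLocalMax {u u' : ℝ → ℝ} {x c : ℝ}
    (h1 : ∀ᶠ t in 𝓝 x, HasDerivAt u (u' t) t) (h2 : HasDerivAt u' c x)
    (h : IsLocalMax u x) : c ≤ 0 := by
  by_contra! hc
  have he : deriv u =ᶠ[𝓝 x] u' := h1.mono fun t ht => ht.deriv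
  have hdd : deriv (deriv u) x = c := by rw [he.deriv_eq, h2.deriv]
  have hmin : IsLocalMin u x := isLocalMin_of_deriv_deriv_pos (by rw [hdd]; exact hc)
    h.deriv_eq_zero h1.self_of_nhds.continuousAt
  have hconst : u =ᶠ[𝓝 x] fun _ => u x := by
    filter_upwards [h, hmin] with t h1 h2 using le_antisymm h1 h2
  have h0 : deriv (deriv u) x = 0 := by
    rw [(hconst.deriv).deriv_eq]; simp
  linarith

theorem second_deriv_nonneg_of_isLocalMin {u u' : ℝ → ℝ} {x c : ℝ}
    (h1 : ∀ᶠ t in 𝓝 x, HasDerivAt u (u' t) t) (h2 : HasDerivAt u' c x)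
    (h : IsLocalMin u x) : 0 ≤ c := by
  have := second_deriv_nonpos_of_isLocalMax (u := -u) (u' := -u') (c := -c)
    (h1.mono fun t ht => ht.neg) h2.neg h.neg
  linarith

theorem PainleveSol.hasDerivAt {α : ℝ} {y : ℝ → ℝ} (hy : PainleveSol α y) (s : ℝ) :
    HasDerivAt y (deriv y s) s :=
  ((hy.1.differentiable (by norm_num)) s).hasDerivAt

theorem PainleveSol.hasDerivAt_deriv {α : ℝ} {y : ℝ → ℝ} (hy : PainleveSol α y) (s : ℝ) :
    HasDerivAt (deriv y) (s * y s + 2 * (y s) ^ 3 + α) s := by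
  have h : ContDiff ℝ 1 (deriv y) := by
    have := hy.1
    rw [show (2 : WithTop ℕ∞) = 1 + 1 by norm_num, contDiff_succ_iff_deriv] at this
    exact this.2.2
  rw [← hy.2 s]
  exact ((h.differentiable (by norm_num)) s).hasDerivAt

theorem PainleveSol.hasDerivAt_deriv_zero {y : ℝ → ℝ} (hy : PainleveSol 0 y) (s : ℝ) :
    HasDerivAt (deriv y) (y s * (s + 2 * (y s) ^ 2)) s :=
  (hy.hasDerivAt_deriv s).congr_deriv (by ring)

theorem PainleveSol.continuous {α : ℝ} {y : ℝ → ℝ} (hy : PainleveSol α y) : Continuous y :=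
  hy.1.continuous

/-! ### Barriers -/

/-- A Keller–Osserman type upper bound for solutions. -/
theorem PainleveSol.le_sqrt_add {y : ℝ → ℝ} (hy : PainleveSol 0 y) {c r T : ℝ} (hr : 0 < r)
    (hT : 0 ≤ T) (hc : r - c ≤ T) : y c ≤ √(T / 2) + 2 / r := by
  by_contra! hlt
  set K := √(T / 2) with hK
  have hK2 : K ^ 2 = T / 2 := Real.sq_sqrt (by positivity)
  have hK0 : 0 ≤ K := Real.sqrt_nonneg _
  obtain ⟨M, hM⟩ := (isCompact_Icc (a := c - r) (b := c + r)).exists_bound_of_continuousOn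
    hy.continuous.continuousOn
  have hM0 : 0 ≤ M := (norm_nonneg _).trans (hM c ⟨by linarith, by linarith⟩)
  set δ := min (r / 2) (1 / (M + 1)) with hδ
  have hδ0 : 0 < δ := lt_min (by linarith) (by positivity)
  have hδr : δ ≤ r / 2 := min_le_left _ _
  have hδM : M + 1 ≤ δ⁻¹ := by
    have h1 : δ ≤ 1 / (M + 1) := min_le_right _ _
    rw [le_inv_comm₀ (by positivity) hδ0]
    simpa using h1
  set B : ℝ → ℝ := fun x => K + (r + (x - c))⁻¹ + (r - (x - c))⁻¹ with hB
  set B' : ℝ → ℝ := fun x => -((r + (x - c)) ^ 2)⁻¹ + ((r - (x - c)) ^ 2)⁻¹ with hB'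
  have dB : ∀ x ∈ Ioo (c - r) (c + r), HasDerivAt B (B' x) x := by
    intro x hx
    have h1 : HasDerivAt (fun x => r + (x - c)) 1 x :=
      ((hasDerivAt_id x).sub_const c).const_add r
    have h2 : HasDerivAt (fun x => r - (x - c)) (-1) x :=
      ((hasDerivAt_id x).sub_const c).const_sub r
    have h3 := (h1.fun_inv (by linarith [hx.1])).const_add K
    have h4 := h2.fun_inv (by linarith [hx.2])
    refine (h3.add h4).congr_deriv ?_
    simp only [hB']
    ring
  have dB' : ∀ x ∈ Ioo (c - r) (c + r), HasDerivAt B'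
      (2 * (r + (x - c))⁻¹ ^ 3 + 2 * (r - (x - c))⁻¹ ^ 3) x := by
    intro x hx
    have n1 : r + (x - c) ≠ 0 := by linarith [hx.1]
    have n2 : r - (x - c) ≠ 0 := by linarith [hx.2]
    have h1 : HasDerivAt (fun x => r + (x - c)) 1 x :=
      ((hasDerivAt_id x).sub_const c).const_add r
    have h2 : HasDerivAt (fun x => r - (x - c)) (-1) x :=
      ((hasDerivAt_id x).sub_const c).const_sub r
    have h3 := ((h1.fun_pow 2).fun_inv (pow_ne_zero 2 n1)).fun_neg
    have h4 := (h2.fun_pow 2).fun_inv (pow_ne_zero 2 n2)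
    refine (h3.add h4).congr_deriv ?_
    field_simp
    ring
  have hsub : Icc (c - (r - δ)) (c + (r - δ)) ⊆ Ioo (c - r) (c + r) := fun x hx =>
    ⟨by linarith [hx.1], by linarith [hx.2]⟩
  have hDc : ContinuousOn (fun x => y x - B x) (Icc (c - (r - δ)) (c + (r - δ))) := fun x hx =>
    (hy.continuous.continuousAt.sub (dB x (hsub hx)).continuousAt).continuousWithinAt
  have hcmem : c ∈ Icc (c - (r - δ)) (c + (r - δ)) := ⟨by linarith, by linarith⟩
  obtain ⟨x, hx, hmax⟩ := isCompact_Icc.exists_isMaxOn ⟨c, hcmem⟩ hDc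
  have hpos : 0 < y x - B x := by
    have h1 : y c - B c ≤ y x - B x := hmax hcmem
    have h2 : B c = K + 2 / r := by simp only [hB]; ring
    linarith
  have hxM : y x ≤ M := (le_abs_self _).trans (hM x (Ioo_subset_Icc_self (hsub hx)))
  have ha : 0 < (r + (x - c))⁻¹ := inv_pos.2 (by linarith [(hsub hx).1])
  have hb : 0 < (r - (x - c))⁻¹ := inv_pos.2 (by linarith [(hsub hx).2])
  have hne1 : x ≠ c - (r - δ) := by
    intro h
    have : (r + (x - c))⁻¹ = δ⁻¹ := by congr 1; linarith
    simp only [hB] at hpos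
    linarith
  have hne2 : x ≠ c + (r - δ) := by
    intro h
    have : (r - (x - c))⁻¹ = δ⁻¹ := by congr 1; linarith
    simp only [hB] at hpos
    linarith
  have hloc : IsLocalMax (fun x => y x - B x) x := hmax.isLocalMax
    (Icc_mem_nhds (lt_of_le_of_ne hx.1 (Ne.symm hne1)) (lt_of_le_of_ne hx.2 hne2))
  have key := second_deriv_nonpos_of_isLocalMax (u' := fun t => deriv y t - B' t)
    (Filter.mem_of_superset (Ioo_mem_nhds (hsub hx).1 (hsub hx).2) fun t ht =>
      (hy.hasDerivAt t).sub (dB t ht))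
    ((hy.hasDerivAt_deriv_zero x).sub (dB' x (hsub hx))) hloc
  have hxT : -T ≤ x := by linarith [(hsub hx).1]
  simp only [hB] at hpos
  set a := (r + (x - c))⁻¹
  set b := (r - (x - c))⁻¹
  set Y := y x
  have hY : 0 < Y := by linarith
  have hd : a + b ≤ Y - K := by linarith
  have e1 : (a + b) ^ 2 ≤ Y ^ 2 - K ^ 2 := by nlinarith
  have e2 : Y * (2 * (Y ^ 2 - K ^ 2)) ≤ Y * (x + 2 * Y ^ 2) :=
    mul_le_mul_of_nonneg_left (by linarith) hY.le
  have e3 : (a + b) * (2 * (a + b) ^ 2) ≤ Y * (2 * (Y ^ 2 - K ^ 2)) :=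
    mul_le_mul (by linarith) (by linarith) (by positivity) hY.le
  have : 0 < a * b * (a + b) := by positivity
  nlinarith

/-- A lower bound for positive solutions, obtained from the subsolution `k cos ((x - c) / r)`. -/
theorem PainleveSol.le_of_pos {y : ℝ → ℝ} (hy : PainleveSol 0 y) (hpos : ∀ s, 0 < y s)
    {c r k : ℝ} (hr : 0 < r) (hk : 0 ≤ k)
    (h : c + Real.pi / 2 * r + 2 * k ^ 2 + (r ^ 2)⁻¹ ≤ 0) : k ≤ y c := by
  by_contra! hlt
  set l := Real.pi / 2 * r with hl
  have hl0 : 0 < l := by positivity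
  set b : ℝ → ℝ := fun x => k * Real.cos ((x - c) / r) with hb
  set b' : ℝ → ℝ := fun x => -(k / r) * Real.sin ((x - c) / r) with hb'
  have d0 : ∀ x, HasDerivAt (fun x => (x - c) / r) (1 / r) x := fun x =>
    ((hasDerivAt_id x).sub_const c).div_const r
  have db : ∀ x, HasDerivAt b (b' x) x := fun x =>
    (((d0 x).cos).const_mul k).congr_deriv (by simp only [hb']; ring)
  have db' : ∀ x, HasDerivAt b' (-(r ^ 2)⁻¹ * b x) x := fun x =>
    (((d0 x).sin).const_mul (-(k / r))).congr_deriv (by simp only [hb]; field_simp)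
  have hbc : Continuous b := continuous_iff_continuousAt.2 fun x => (db x).continuousAt
  have hcmem : c ∈ Icc (c - l) (c + l) := ⟨by linarith, by linarith⟩
  obtain ⟨x, hx, hmax⟩ := isCompact_Icc.exists_isMaxOn ⟨c, hcmem⟩
    (hbc.div hy.continuous fun x => (hpos x).ne').continuousOn
  set μ := b x / y x with hμ
  have hμ1 : 1 < μ := by
    have h1 : b c / y c ≤ μ := hmax hcmem
    have h2 : b c = k := by simp [hb]
    rw [h2] at h1
    exact ((one_lt_div (hpos c)).2 hlt).trans_le h1
  have hne1 : x ≠ c - l := by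
    intro h
    have : b x = 0 := by
      have : (x - c) / r = -(Real.pi / 2) := by rw [h, hl]; field_simp; ring
      simp [hb, this]
    rw [hμ, this] at hμ1
    norm_num at hμ1
  have hne2 : x ≠ c + l := by
    intro h
    have : b x = 0 := by
      have : (x - c) / r = Real.pi / 2 := by rw [h, hl]; field_simp; ring
      simp [hb, this]
    rw [hμ, this] at hμ1
    norm_num at hμ1
  have hnhds : Icc (c - l) (c + l) ∈ 𝓝 x :=
    Icc_mem_nhds (lt_of_le_of_ne hx.1 (Ne.symm hne1)) (lt_of_le_of_ne hx.2 hne2)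
  have hbx : b x = μ * y x := by rw [hμ, div_mul_cancel₀ _ (hpos x).ne']
  have hloc : IsLocalMin (fun t => μ * y t - b t) x := by
    filter_upwards [hnhds] with t ht
    have h1 : b t / y t ≤ μ := hmax ht
    rw [div_le_iff₀ (hpos t)] at h1
    linarith
  have key := second_deriv_nonneg_of_isLocalMin (u' := fun t => μ * deriv y t - b' t)
    (Eventually.of_forall fun t => ((hy.hasDerivAt t).const_mul μ).sub (db t))
    (((hy.hasDerivAt_deriv_zero x).const_mul μ).sub (db' x)) hloc
  have hbk : b x ≤ k := by
    simpa using mul_le_mul_of_nonneg_left (Real.cos_le_one ((x - c) / r)) hk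
  have hyk : y x < k := by nlinarith [hpos x]
  have hyk2 : y x ^ 2 < k ^ 2 := by nlinarith [hpos x]
  have hs : x + 2 * y x ^ 2 + (r ^ 2)⁻¹ < 0 := by linarith [hx.2]
  rw [hbx] at key
  have : 0 < μ * y x := mul_pos (by linarith) (hpos x)
  nlinarith

/-! ### Asymptotic behaviour of positive solutions -/

theorem PainleveSol.le_two_div {y : ℝ → ℝ} (hy : PainleveSol 0 y) {s : ℝ} (hs : 0 < s) :
    y s ≤ 2 / s := by
  simpa using hy.le_sqrt_add hs le_rfl (by simp : s - s ≤ 0)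

theorem PainleveSol.tendsto_atTop {y : ℝ → ℝ} (hy : PainleveSol 0 y) (hpos : ∀ s, 0 < y s) :
    Tendsto y atTop (𝓝 0) := by
  refine squeeze_zero' (Eventually.of_forall fun s => (hpos s).le)
    ((eventually_gt_atTop 0).mono fun s hs => hy.le_two_div hs) ?_
  exact tendsto_const_nhds.div_atTop tendsto_id

theorem PainleveSol.strictMonoOn_deriv {y : ℝ → ℝ} (hy : PainleveSol 0 y) (hpos : ∀ s, 0 < y s) :
    StrictMonoOn (deriv y) (Ici 0) := by
  refine strictMonoOn_of_hasDerivWithinAt_pos (convex_Ici 0)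
    (fun s _ => (hy.hasDerivAt_deriv_zero s).continuousAt.continuousWithinAt)
    (fun s _ => (hy.hasDerivAt_deriv_zero s).hasDerivWithinAt) fun s hs => ?_
  rw [interior_Ici] at hs
  have hs' : 0 < s := hs
  have := hpos s
  positivity

theorem PainleveSol.tendsto_deriv_atTop {y : ℝ → ℝ} (hy : PainleveSol 0 y)
    (hpos : ∀ s, 0 < y s) : Tendsto (deriv y) atTop (𝓝 0) := by
  have h0 := hy.tendsto_atTop hpos
  have h1 : Tendsto (fun s => y (s + 1)) atTop (𝓝 0) :=
    h0.comp (tendsto_atTop_add_const_right _ _ tendsto_id)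
  have h2 : Tendsto (fun s => -y (s - 1)) atTop (𝓝 0) := by
    simpa [sub_eq_add_neg] using (h0.comp (tendsto_atTop_add_const_right _ (-1) tendsto_id)).neg
  have hm := (hy.strictMonoOn_deriv hpos).monotoneOn
  refine tendsto_of_tendsto_of_tendsto_of_le_of_le' h2 h1 ?_ ?_
  · filter_upwards [eventually_ge_atTop 1] with s hs
    obtain ⟨t, ht, he⟩ := exists_hasDerivAt_eq_slope y (deriv y) (show s - 1 < s by linarith)
      hy.continuous.continuousOn fun t _ => hy.hasDerivAt t
    have h3 : deriv y t ≤ deriv y s :=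
      hm (show (0 : ℝ) ≤ t by linarith [ht.1]) (show (0 : ℝ) ≤ s by linarith) ht.2.le
    rw [he] at h3
    have : s - (s - 1) = 1 := by ring
    rw [this, div_one] at h3
    linarith [hpos s]
  · filter_upwards [eventually_ge_atTop 1] with s hs
    obtain ⟨t, ht, he⟩ := exists_hasDerivAt_eq_slope y (deriv y) (show s < s + 1 by linarith)
      hy.continuous.continuousOn fun t _ => hy.hasDerivAt t
    have h3 : deriv y s ≤ deriv y t :=
      hm (show (0 : ℝ) ≤ s by linarith) (show (0 : ℝ) ≤ t by linarith [ht.1]) ht.1.le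
    rw [he] at h3
    have : s + 1 - s = 1 := by ring
    rw [this, div_one] at h3
    linarith [hpos s]

theorem tendsto_sqrt_abs_half_atBot : Tendsto (fun s : ℝ => √(|s| / 2)) atBot atTop :=
  Real.tendsto_sqrt_atTop.comp (tendsto_abs_atBot_atTop.atTop_div_const (by norm_num))

theorem PainleveSol.tendsto_sub_sqrt_atBot {y : ℝ → ℝ} (hy : PainleveSol 0 y)
    (hpos : ∀ s, 0 < y s) : Tendsto (fun s => y s - √(|s| / 2)) atBot (𝓝 0) := by
  rw [Metric.tendsto_nhds]
  intro ε hε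
  set r := 8 / ε with hr
  have hr0 : 0 < r := by positivity
  filter_upwards [eventually_le_atBot 0,
    tendsto_sqrt_abs_half_atBot.eventually_ge_atTop (r / ε),
    tendsto_sqrt_abs_half_atBot.eventually_ge_atTop ε,
    tendsto_sqrt_abs_half_atBot.eventually_ge_atTop ((1 + Real.pi / 2 + ε ^ 2 / 2) / (2 * ε))]
    with s hs h1 h2 h3
  set t := √(|s| / 2) with ht
  have ht2 : t ^ 2 = -s / 2 := by
    rw [ht, Real.sq_sqrt (by positivity), abs_of_nonpos hs]
  have ht0 : 0 ≤ t := Real.sqrt_nonneg _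
  rw [div_le_iff₀ hε] at h1
  rw [div_le_iff₀ (by positivity)] at h3
  have hup := hy.le_sqrt_add (c := s) hr0 (by linarith : 0 ≤ r - s) le_rfl
  have hsq : √((r - s) / 2) ≤ t + ε / 2 := Real.sqrt_le_iff.2 ⟨by linarith, by nlinarith⟩
  have hr2 : 2 / r = ε / 4 := by rw [hr]; field_simp; norm_num
  have hlow := hy.le_of_pos hpos (c := s) (r := 1) (k := t - ε / 2) one_pos (by linarith)
    (by norm_num; nlinarith)
  rw [Real.dist_eq, sub_zero, abs_lt]
  constructor <;> linarith

theorem hasDerivAt_comp_neg_of {u : ℝ → ℝ} {c s : ℝ} (h : HasDerivAt u c (-s)) :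
    HasDerivAt (fun t => u (-t)) (-c) s :=
  (h.scomp s (hasDerivAt_neg s)).congr_deriv (by simp)

/-! ### Comparison through the Wronskian -/

theorem ratio_le_of_wronskian_nonneg {p p' q q' P Q : ℝ → ℝ}
    (hp : ∀ s, HasDerivAt p (p' s) s) (hp' : ∀ s, HasDerivAt p' (p s * P s) s)
    (hq : ∀ s, HasDerivAt q (q' s) s) (hq' : ∀ s, HasDerivAt q' (q s * Q s) s)
    (ppos : ∀ s, 0 < p s) (qpos : ∀ s, 0 < q s) (hPQ : ∀ s, q s < p s → Q s < P s)
    {a : ℝ} (ha : q a < p a) (hW : 0 ≤ p' a * q a - p a * q' a) :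
    (∀ t, a ≤ t → p a / q a ≤ p t / q t) ∧
      StrictMonoOn (fun t => p' t * q t - p t * q' t) (Ici a) := by
  have hpc : Continuous p := continuous_iff_continuousAt.2 fun s => (hp s).continuousAt
  have hqc : Continuous q := continuous_iff_continuousAt.2 fun s => (hq s).continuousAt
  set W : ℝ → ℝ := fun t => p' t * q t - p t * q' t with hWdef
  have dW : ∀ s, HasDerivAt W (p s * q s * (P s - Q s)) s := fun s =>
    (((hp' s).mul (hq s)).sub ((hp s).mul (hq' s))).congr_deriv (by ring)
  have dρ : ∀ s, HasDerivAt (fun t => p t / q t) (W s / q s ^ 2) s := fun s =>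
    (hp s).fun_div (hq s) (qpos s).ne'
  have hWc : Continuous W := continuous_iff_continuousAt.2 fun s => (dW s).continuousAt
  have hρc : Continuous fun t => p t / q t :=
    continuous_iff_continuousAt.2 fun s => (dρ s).continuousAt
  -- as long as `q < p`, the Wronskian and the ratio increase
  have step : ∀ b, a ≤ b → (∀ t ∈ Ioo a b, q t < p t) → p a / q a ≤ p b / q b := by
    intro b hab hb
    have hWm : MonotoneOn W (Icc a b) := by
      refine monotoneOn_of_hasDerivWithinAt_nonneg (convex_Icc a b) hWc.continuousOn
        (fun s _ => (dW s).hasDerivWithinAt) fun s hs => ?_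
      rw [interior_Icc] at hs
      have := hPQ s (hb s hs)
      have h1 := ppos s
      have h2 := qpos s
      exact mul_nonneg (mul_nonneg h1.le h2.le) (by linarith)
    have hρm : MonotoneOn (fun t => p t / q t) (Icc a b) := by
      refine monotoneOn_of_hasDerivWithinAt_nonneg (convex_Icc a b) hρc.continuousOn
        (fun s _ => (dρ s).hasDerivWithinAt) fun s hs => ?_
      rw [interior_Icc] at hs
      have : W a ≤ W s := hWm ⟨le_rfl, hab⟩ (Ioo_subset_Icc_self hs) hs.1.le
      exact div_nonneg (hW.trans this) (sq_nonneg _)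
    exact hρm ⟨le_rfl, hab⟩ ⟨hab, le_rfl⟩ hab
  have hρa : 1 < p a / q a := (one_lt_div (qpos a)).2 ha
  have hall : ∀ t, a ≤ t → q t < p t := by
    by_contra! hcon
    obtain ⟨b, hab, hb⟩ := hcon
    have hcomp : IsCompact (Icc a b ∩ {t | p t ≤ q t}) :=
      isCompact_Icc.inter_right (isClosed_le hpc hqc)
    obtain ⟨c, ⟨hc, hc2⟩, hmin⟩ := hcomp.exists_isLeast ⟨b, ⟨hab, le_rfl⟩, hb⟩
    have h1 := step c hc.1 fun t ht => by
      by_contra! h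
      exact absurd (hmin ⟨⟨ht.1.le, ht.2.le.trans hc.2⟩, h⟩) (not_le.2 ht.2)
    have h2 : p c / q c ≤ 1 := (div_le_one (qpos c)).2 hc2
    linarith
  refine ⟨fun t ht => step t ht fun s hs => hall s hs.1.le, ?_⟩
  refine strictMonoOn_of_hasDerivWithinAt_pos (convex_Ici a) hWc.continuousOn
    (fun s _ => (dW s).hasDerivWithinAt) fun s hs => ?_
  rw [interior_Ici] at hs
  have := hPQ s (hall s (le_of_lt hs))
  exact mul_pos (mul_pos (ppos s) (qpos s)) (by linarith)

theorem le_of_tendsto_wronskian {p p' q q' P Q : ℝ → ℝ}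
    (hp : ∀ s, HasDerivAt p (p' s) s) (hp' : ∀ s, HasDerivAt p' (p s * P s) s)
    (hq : ∀ s, HasDerivAt q (q' s) s) (hq' : ∀ s, HasDerivAt q' (q s * Q s) s)
    (ppos : ∀ s, 0 < p s) (qpos : ∀ s, 0 < q s) (hPQ : ∀ s, q s < p s → Q s < P s)
    (hW : Tendsto (fun t => p' t * q t - p t * q' t) atTop (𝓝 0))
    (hbot : ∀ ε > 0, ∀ᶠ s in atBot, p s - q s < ε) (hq1 : ∀ᶠ s in atBot, 1 ≤ q s) (a : ℝ) :
    p a ≤ q a := by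
  by_contra! ha
  rcases le_or_gt 0 (p' a * q a - p a * q' a) with h | h
  · have hm := (ratio_le_of_wronskian_nonneg hp hp' hq hq' ppos qpos hPQ ha h).2
    have h1 : p' a * q a - p a * q' a < p' (a + 1) * q (a + 1) - p (a + 1) * q' (a + 1) :=
      hm (show a ≤ a by exact le_rfl) (show a ≤ a + 1 by linarith) (by linarith)
    have h2 : p' (a + 1) * q (a + 1) - p (a + 1) * q' (a + 1) ≤ 0 := by
      refine ge_of_tendsto hW ?_
      filter_upwards [eventually_ge_atTop (a + 1)] with t ht
      exact hm.monotoneOn (show a ≤ a + 1 by linarith) (show a ≤ t by linarith) ht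
    linarith
  · have hneg : ∀ {u u' : ℝ → ℝ}, (∀ s, HasDerivAt u (u' s) s) →
        ∀ s, HasDerivAt (fun t => u (-t)) (-u' (-s)) s := fun hu s =>
      hasDerivAt_comp_neg_of (hu (-s))
    have hneg' : ∀ {u u' R : ℝ → ℝ}, (∀ s, HasDerivAt u' (u s * R s) s) →
        ∀ s, HasDerivAt (fun t => -u' (-t)) (u (-s) * R (-s)) s := by
      intro u u' R hu s
      simpa using (hneg hu s).fun_neg
    have hr := (ratio_le_of_wronskian_nonneg (a := -a) (hneg hp) (hneg' hp') (hneg hq)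
      (hneg' hq') (fun s => ppos _) (fun s => qpos _) (fun s => hPQ _) (by simpa using ha)
      (by simp only [neg_neg]; linarith)).1
    simp only [neg_neg] at hr
    have hρa : 1 < p a / q a := (one_lt_div (qpos a)).2 ha
    obtain ⟨s, h1, h2, h3⟩ := ((hbot (p a / q a - 1) (by linarith)).and
      (hq1.and (eventually_le_atBot a))).exists
    have h4 := hr (-s) (by linarith)
    rw [neg_neg, le_div_iff₀ (qpos s)] at h4
    nlinarith

theorem PainleveSol.eq_of_pos {y z : ℝ → ℝ} (hy : PainleveSol 0 y) (hz : PainleveSol 0 z)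
    (ypos : ∀ s, 0 < y s) (zpos : ∀ s, 0 < z s) : z = y := by
  have key : ∀ {y z : ℝ → ℝ}, PainleveSol 0 y → PainleveSol 0 z →
      (∀ s, 0 < y s) → (∀ s, 0 < z s) → ∀ s, z s ≤ y s := by
    intro y z hy hz ypos zpos
    refine le_of_tendsto_wronskian hz.hasDerivAt hz.hasDerivAt_deriv_zero hy.hasDerivAt
      hy.hasDerivAt_deriv_zero zpos ypos (fun s h => ?_) ?_ ?_ ?_
    · have := ypos s
      nlinarith
    · simpa using ((hz.tendsto_deriv_atTop zpos).mul (hy.tendsto_atTop ypos)).sub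
        ((hz.tendsto_atTop zpos).mul (hy.tendsto_deriv_atTop ypos))
    · intro ε hε
      have h := (hz.tendsto_sub_sqrt_atBot zpos).sub (hy.tendsto_sub_sqrt_atBot ypos)
      rw [sub_zero] at h
      filter_upwards [h.eventually_lt_const hε] with s hs
      linarith
    · filter_upwards [(hy.tendsto_sub_sqrt_atBot ypos).eventually_const_lt (show (-1 : ℝ) < 0 by
        norm_num), tendsto_sqrt_abs_half_atBot.eventually_ge_atTop 2] with s h1 h2
      linarith
  exact funext fun s => le_antisymm (key hy hz ypos zpos s) (key hz hy zpos ypos s)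

/-! ### Monotonicity and decay -/

theorem PainleveSol.add_le {y : ℝ → ℝ} (hy : PainleveSol 0 y) (ypos : ∀ s, 0 < y s) {h : ℝ}
    (hh : 0 < h) (s : ℝ) : y (s + h) ≤ y s := by
  have d1 : ∀ s, HasDerivAt (fun s => y (s + h)) (deriv y (s + h)) s := fun s =>
    (hy.hasDerivAt (s + h)).comp_add_const s h
  have d2 : ∀ s, HasDerivAt (fun s => deriv y (s + h))
      (y (s + h) * (s + h + 2 * y (s + h) ^ 2)) s := fun s =>
    (hy.hasDerivAt_deriv_zero (s + h)).comp_add_const s h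
  have ht : Tendsto (fun s : ℝ => s + h) atTop atTop :=
    tendsto_atTop_add_const_right _ _ tendsto_id
  have hb : Tendsto (fun s : ℝ => s + h) atBot atBot :=
    tendsto_atBot_add_const_right _ _ tendsto_id
  refine le_of_tendsto_wronskian (P := fun s => s + h + 2 * y (s + h) ^ 2) d1 d2 hy.hasDerivAt
    hy.hasDerivAt_deriv_zero (fun s => ypos _) ypos (fun s h => ?_) ?_ ?_ ?_ s
  · have := ypos s
    nlinarith
  · simpa using (((hy.tendsto_deriv_atTop ypos).comp ht).mul (hy.tendsto_atTop ypos)).sub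
      (((hy.tendsto_atTop ypos).comp ht).mul (hy.tendsto_deriv_atTop ypos))
  · intro ε hε
    have h0 := ((hy.tendsto_sub_sqrt_atBot ypos).comp hb).sub (hy.tendsto_sub_sqrt_atBot ypos)
    rw [sub_zero] at h0
    filter_upwards [h0.eventually_lt_const hε, eventually_le_atBot (-h)] with s hs hsh
    have : √(|s + h| / 2) ≤ √(|s| / 2) := by
      refine Real.sqrt_le_sqrt ?_
      rw [abs_of_nonpos (by linarith : s + h ≤ 0), abs_of_nonpos (by linarith : s ≤ 0)]
      linarith
    simp only [Function.comp] at hs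
    linarith
  · filter_upwards [(hy.tendsto_sub_sqrt_atBot ypos).eventually_const_lt (show (-1 : ℝ) < 0 by
      norm_num), tendsto_sqrt_abs_half_atBot.eventually_ge_atTop 2] with s h1 h2
    linarith

theorem PainleveSol.deriv_neg {y : ℝ → ℝ} (hy : PainleveSol 0 y) (ypos : ∀ s, 0 < y s)
    (s : ℝ) : deriv y s < 0 := by
  have hanti : Antitone y := fun a b hab => by
    rcases hab.eq_or_lt with rfl | hlt
    · rfl
    · simpa using hy.add_le ypos (sub_pos.2 hlt) a
  have hle : ∀ t, deriv y t ≤ 0 := fun t => hanti.deriv_nonpos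
  refine lt_of_le_of_ne (hle s) fun h0 => ?_
  have hmax : IsLocalMax (deriv y) s := Eventually.of_forall fun t => by
    rw [h0]; exact hle t
  have hd : HasDerivAt (fun t => y t * (t + 2 * y t ^ 2)) (y s) s :=
    ((hy.hasDerivAt s).fun_mul ((hasDerivAt_id s).fun_add
      (((hy.hasDerivAt s).fun_pow 2).const_mul 2))).congr_deriv (by simp [h0])
  have := second_deriv_nonpos_of_isLocalMax
    (Eventually.of_forall fun t => hy.hasDerivAt_deriv_zero t) hd hmax
  linarith [ypos s]

theorem PainleveSol.deriv_le_neg_sqrt_mul {y : ℝ → ℝ} (hy : PainleveSol 0 y)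
    (ypos : ∀ s, 0 < y s) {s : ℝ} (hs : 0 ≤ s) : deriv y s ≤ -(√s * y s) := by
  set G : ℝ → ℝ := fun t => deriv y t ^ 2 - t * y t ^ 2 with hG
  have dG : ∀ t, HasDerivAt G (4 * y t ^ 3 * deriv y t - y t ^ 2) t := fun t =>
    (((hy.hasDerivAt_deriv_zero t).fun_pow 2).fun_sub ((hasDerivAt_id t).fun_mul
      ((hy.hasDerivAt t).fun_pow 2))).congr_deriv (by simp; ring)
  have hGa : Antitone G := antitone_of_hasDerivAt_nonpos dG fun t => by
    have h1 := hy.deriv_neg ypos t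
    have h2 := ypos t
    have h3 : 0 < y t ^ 3 := by positivity
    show 4 * y t ^ 3 * deriv y t - y t ^ 2 ≤ 0
    nlinarith
  have hlim : Tendsto (fun t => t * y t ^ 2) atTop (𝓝 0) := by
    have h4 : Tendsto (fun t : ℝ => 4 / t) atTop (𝓝 0) :=
      tendsto_const_nhds.div_atTop tendsto_id
    refine squeeze_zero' ((eventually_ge_atTop 0).mono fun t ht => by positivity)
      ((eventually_gt_atTop 0).mono fun t ht => ?_) h4
    have h1 := hy.le_two_div ht
    have h2 : y t ^ 2 ≤ (2 / t) ^ 2 := pow_le_pow_left₀ (ypos t).le h1 2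
    calc t * y t ^ 2 ≤ t * (2 / t) ^ 2 := mul_le_mul_of_nonneg_left h2 ht.le
      _ = 4 / t := by field_simp; norm_num
  have hGlim : Tendsto G atTop (𝓝 0) := by
    simpa using ((hy.tendsto_deriv_atTop ypos).pow 2).sub hlim
  have hGs : 0 ≤ G s := le_of_tendsto hGlim ((eventually_ge_atTop s).mono fun t ht => hGa ht)
  have h1 : (√s * y s) ^ 2 ≤ (-deriv y s) ^ 2 := by
    rw [mul_pow, Real.sq_sqrt hs, neg_sq]
    simp only [hG] at hGs
    linarith
  have h2 := abs_le_of_sq_le_sq h1 (by linarith [hy.deriv_neg ypos s])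
  linarith [(le_abs_self _).trans h2]

theorem PainleveSol.le_mul_exp {y : ℝ → ℝ} (hy : PainleveSol 0 y) (ypos : ∀ s, 0 < y s) {s : ℝ}
    (hs : 0 ≤ s) : y s ≤ y 0 * Real.exp (-(2/3) * s ^ ((3:ℝ)/2)) := by
  have dψ : ∀ t : ℝ, HasDerivAt (fun t : ℝ => Real.exp ((2/3) * t ^ ((3:ℝ)/2)))
      (Real.exp ((2/3) * t ^ ((3:ℝ)/2)) * √t) t := fun t => by
    have h := ((Real.hasDerivAt_rpow_const (x := t) (p := 3/2) (Or.inr (by norm_num))).const_mul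
      (2/3 : ℝ)).exp
    refine h.congr_deriv ?_
    rw [Real.sqrt_eq_rpow, show (3:ℝ)/2 - 1 = 1/2 by norm_num]
    ring
  have d : ∀ t : ℝ, HasDerivAt (fun t : ℝ => y t * Real.exp ((2/3) * t ^ ((3:ℝ)/2)))
      (Real.exp ((2/3) * t ^ ((3:ℝ)/2)) * (deriv y t + √t * y t)) t := fun t =>
    ((hy.hasDerivAt t).fun_mul (dψ t)).congr_deriv (by ring)
  have ha : AntitoneOn (fun t : ℝ => y t * Real.exp ((2/3) * t ^ ((3:ℝ)/2))) (Ici 0) := by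
    refine antitoneOn_of_hasDerivWithinAt_nonpos (convex_Ici 0)
      (fun t _ => (d t).continuousAt.continuousWithinAt) (fun t _ => (d t).hasDerivWithinAt)
      fun t ht => ?_
    rw [interior_Ici] at ht
    have := hy.deriv_le_neg_sqrt_mul ypos (le_of_lt ht : 0 ≤ t)
    exact mul_nonpos_of_nonneg_of_nonpos (Real.exp_pos _).le (by linarith)
  have h := ha (show (0 : ℝ) ≤ 0 from le_rfl) hs hs
  simp only [Real.zero_rpow (show (3:ℝ)/2 ≠ 0 by norm_num), mul_zero, Real.exp_zero, mul_one] at h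
  rw [neg_mul, Real.exp_neg, ← div_eq_mul_inv, le_div_iff₀ (Real.exp_pos _)]
  exact h

/-! ### Positivity of nonnegative solutions -/

theorem eq_zero_of_linear_ode {u u' q : ℝ → ℝ} (hu : ∀ s, HasDerivAt u (u' s) s)
    (hu' : ∀ s, HasDerivAt u' (u s * q s) s) (hq : Continuous q) {a : ℝ} (h0 : u a = 0)
    (h1 : u' a = 0) {t : ℝ} (ht : a ≤ t) : u t = 0 := by
  obtain ⟨M, hM⟩ := (isCompact_Icc (a := a) (b := t)).exists_bound_of_continuousOn hq.continuousOn
  have hd : ∀ s, HasDerivAt (fun s => (u s, u' s)) (u' s, u s * q s) s := fun s =>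
    (hu s).prodMk (hu' s)
  have := eq_zero_of_abs_deriv_le_mul_abs_self_of_eq_zero_right (f := fun s => (u s, u' s))
    (f' := fun s => (u' s, u s * q s)) (K := max 1 M) (a := a) (b := t)
    (fun s _ => (hd s).continuousAt.continuousWithinAt) (fun s _ => (hd s).hasDerivWithinAt)
    (by simp [h0, h1]) (fun s hs => ?_) t ⟨ht, le_rfl⟩
  · exact (Prod.mk.inj this).1
  · rw [Prod.norm_def, Prod.norm_def]
    have hq' := hM s (Ico_subset_Icc_self hs)
    refine max_le ?_ ?_
    · calc ‖u' s‖ ≤ max ‖u s‖ ‖u' s‖ := le_max_right _ _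
        _ ≤ max 1 M * max ‖u s‖ ‖u' s‖ :=
          le_mul_of_one_le_left (le_max_of_le_left (norm_nonneg _)) (le_max_left _ _)
    · rw [norm_mul, mul_comm]
      exact mul_le_mul (hq'.trans (le_max_right _ _)) (le_max_left _ _) (norm_nonneg _)
        (le_max_of_le_left zero_le_one)

theorem PainleveSol.pos_of_nonneg {y : ℝ → ℝ} (hy : PainleveSol 0 y) (hnn : ∀ s, 0 ≤ y s)
    (hne : y ≠ 0) (s : ℝ) : 0 < y s := by
  refine lt_of_le_of_ne (hnn s) fun h => hne ?_
  have h0 : y s = 0 := h.symm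
  have h1 : deriv y s = 0 := IsLocalMin.deriv_eq_zero
    (Eventually.of_forall fun t => by rw [h0]; exact hnn t)
  have hc := hy.continuous
  funext t
  rcases le_total s t with hst | hst
  · exact eq_zero_of_linear_ode hy.hasDerivAt hy.hasDerivAt_deriv_zero (by fun_prop) h0 h1 hst
  · have d1 : ∀ x, HasDerivAt (fun x => y (-x)) (-deriv y (-x)) x := fun x =>
      hasDerivAt_comp_neg_of (hy.hasDerivAt (-x))
    have d2 : ∀ x, HasDerivAt (fun x => -deriv y (-x)) (y (-x) * (-x + 2 * y (-x) ^ 2)) x :=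
      fun x => by
        simpa using (hasDerivAt_comp_neg_of (hy.hasDerivAt_deriv_zero (-x))).fun_neg
    have := eq_zero_of_linear_ode (q := fun x => -x + 2 * y (-x) ^ 2) d1 d2 (by fun_prop)
      (a := -s) (by simpa using h0) (by simpa using h1) (t := -t) (by linarith)
    simpa using this

/-! ### Minimality of positive solutions -/

theorem PainleveSol.minimalSol {y : ℝ → ℝ} (hy : PainleveSol 0 y) (ypos : ∀ s, 0 < y s) :
    MinimalSol 0 y := by
  refine ⟨hy, fun φ hφ hφc => ?_⟩
  have hyc := hy.continuous
  have hy'c : Continuous (deriv y) :=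
    continuous_iff_continuousAt.2 fun s => (hy.hasDerivAt_deriv_zero s).continuousAt
  have hφd : ∀ s, HasDerivAt φ (deriv φ s) s := fun s =>
    ((hφ.differentiable (by norm_num)) s).hasDerivAt
  have hφcont : Continuous φ := hφ.continuous
  have hφ'c : Continuous (deriv φ) := hφ.continuous_deriv (by norm_num)
  have hne : ∀ s, y s ≠ 0 := fun s => (ypos s).ne'
  have hud : deriv (fun s => y s + φ s) = fun s => deriv y s + deriv φ s :=
    funext fun s => ((hy.hasDerivAt s).add (hφd s)).deriv
  set g : ℝ → ℝ := fun s => 1 / 2 * (φ s * (2 * y s + φ s)) * (deriv y s / y s) with hg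
  set g' : ℝ → ℝ := fun s =>
    1 / 2 * (deriv φ s * (2 * y s + φ s) + φ s * (2 * deriv y s + deriv φ s)) *
      (deriv y s / y s) + 1 / 2 * (φ s * (2 * y s + φ s)) *
      (s + 2 * y s ^ 2 - deriv y s ^ 2 / y s ^ 2) with hg'
  have dg : ∀ s, HasDerivAt g (g' s) s := fun s => by
    have h1 := ((hφd s).fun_mul (((hy.hasDerivAt s).const_mul 2).fun_add (hφd s))).const_mul
      (1 / 2)
    refine (h1.fun_mul ((hy.hasDerivAt_deriv_zero s).fun_div (hy.hasDerivAt s)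
      (hne s))).congr_deriv ?_
    simp only [hg']
    have := hne s
    field_simp
  have hφ0 : ∀ s, s ∉ tsupport φ → φ s = 0 := fun s hs => image_eq_zero_of_notMem_tsupport hs
  have hφ'0 : ∀ s, s ∉ tsupport φ → deriv φ s = 0 := fun s hs => by
    by_contra h
    exact hs (support_deriv_subset h)
  have hgc : Continuous g := continuous_iff_continuousAt.2 fun s => (dg s).continuousAt
  have hg'c : Continuous g' := by
    have h1 : Continuous fun s => deriv y s / y s := hy'c.div hyc hne
    have h2 : Continuous fun s => deriv y s ^ 2 / y s ^ 2 :=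
      (hy'c.pow 2).div (hyc.pow 2) fun s => pow_ne_zero 2 (hne s)
    simp only [hg']
    fun_prop
  have hg0 : ∀ s, s ∉ tsupport φ → g s = 0 := fun s hs => by simp [hg, hφ0 s hs]
  have hg'0 : ∀ s, s ∉ tsupport φ → g' s = 0 := fun s hs => by simp [hg', hφ0 s hs, hφ'0 s hs]
  have hgi : Integrable g := hgc.integrable_of_hasCompactSupport (HasCompactSupport.intro hφc hg0)
  have hg'i : Integrable g' :=
    hg'c.integrable_of_hasCompactSupport (HasCompactSupport.intro hφc hg'0)
  have hint : ∫ s in tsupport φ, g' s = 0 := by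
    rw [setIntegral_eq_integral_of_forall_compl_eq_zero hg'0]
    exact integral_eq_zero_of_hasDerivAt_of_integrable dg hg'i hgi
  have hFy : IntegrableOn (fun s => (1:ℝ)/2 * (deriv y s) ^ 2 + 1/2 * s * (y s) ^ 2 +
      1/2 * (y s) ^ 4 + 0 * y s) (tsupport φ) :=
    ContinuousOn.integrableOn_compact hφc (by fun_prop)
  have hFu : IntegrableOn (fun s => (1:ℝ)/2 * (deriv y s + deriv φ s) ^ 2 +
      1/2 * s * (y s + φ s) ^ 2 + 1/2 * (y s + φ s) ^ 4 + 0 * (y s + φ s)) (tsupport φ) :=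
    ContinuousOn.integrableOn_compact hφc (by fun_prop)
  unfold EPII
  rw [hud]
  have hsum := integral_add hFy.integrable hg'i.integrableOn.integrable
  rw [hint, add_zero] at hsum
  rw [← hsum]
  refine setIntegral_mono (hFy.add hg'i.integrableOn) hFu fun s => ?_
  have hid : (1:ℝ)/2 * (deriv y s + deriv φ s) ^ 2 + 1/2 * s * (y s + φ s) ^ 2 +
      1/2 * (y s + φ s) ^ 4 + 0 * (y s + φ s) - ((1:ℝ)/2 * (deriv y s) ^ 2 +
      1/2 * s * (y s) ^ 2 + 1/2 * (y s) ^ 4 + 0 * y s + g' s) =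
      1/2 * (deriv y s + deriv φ s - (y s + φ s) * (deriv y s / y s)) ^ 2 +
      1/2 * ((y s + φ s) ^ 2 - y s ^ 2) ^ 2 := by
    simp only [hg']
    have := hne s
    field_simp
    ring
  have : 0 ≤ (1:ℝ)/2 * (deriv y s + deriv φ s - (y s + φ s) * (deriv y s / y s)) ^ 2 +
      1/2 * ((y s + φ s) ^ 2 - y s ^ 2) ^ 2 := by positivity
  simp only
  linarith

theorem not_minimalSol_zero : ¬ MinimalSol 0 (0 : ℝ → ℝ) := by
  rintro ⟨-, hmin⟩
  let χ : ContDiffBump (0 : ℝ) := ⟨1, 2, one_pos, one_lt_two⟩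
  have hχ : ContDiff ℝ (⊤ : ℕ∞) χ := χ.contDiff
  have hχc : Continuous χ := χ.continuous
  have hχ'c : Continuous (deriv χ) := hχ.continuous_deriv (by norm_num)
  have hχs : HasCompactSupport χ := χ.hasCompactSupport
  have hχ0 : ∀ s, s ∉ tsupport χ → χ s = 0 := fun s hs => image_eq_zero_of_notMem_tsupport hs
  have hχ'0 : ∀ s, s ∉ tsupport χ → deriv χ s = 0 := fun s hs => by
    by_contra h
    exact hs (support_deriv_subset h)
  set h : ℝ → ℝ := fun x => 1/2 * deriv χ x ^ 2 + 1/2 * x * χ x ^ 2 + 1/2 * χ x ^ 4 with hh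
  set b : ℝ → ℝ := fun x => χ x ^ 2 with hb
  have hhi : Integrable h := Continuous.integrable_of_hasCompactSupport (by fun_prop)
    (HasCompactSupport.intro hχs fun s hs => by simp [hh, hχ0 s hs, hχ'0 s hs])
  have hbs : HasCompactSupport b := HasCompactSupport.intro hχs fun s hs => by simp [hb, hχ0 s hs]
  have hbc : Continuous b := by fun_prop
  have hbi : Integrable b := hbc.integrable_of_hasCompactSupport hbs
  have hB : 0 < ∫ x, b x := by
    refine hbc.integral_pos_of_hasCompactSupport_nonneg_nonzero hbs (fun x => sq_nonneg _)
      (x := 0) ?_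
    have : χ 0 = 1 := χ.one_of_mem_closedBall (by simp [χ])
    simp [hb, this]
  set L := 2 * ((∫ x, h x) + 1) / ∫ x, b x with hL
  have hφs : HasCompactSupport fun s => χ (s + L) :=
    hχs.comp_homeomorph (Homeomorph.addRight L)
  have key := hmin (fun s => χ (s + L)) (hχ.comp (contDiff_id.add contDiff_const)) hφs
  have hd : deriv (fun s => χ (s + L)) = fun s => deriv χ (s + L) :=
    funext fun s => deriv_comp_add_const _ _ _
  have hlhs : EPII 0 (0 : ℝ → ℝ) (tsupport fun s => χ (s + L)) = 0 := by
    simp [EPII]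
  have hrhs : EPII 0 (fun s => (0 : ℝ → ℝ) s + χ (s + L)) (tsupport fun s => χ (s + L)) =
      (∫ x, h x) - L / 2 * ∫ x, b x := by
    rw [EPII, setIntegral_eq_integral_of_forall_compl_eq_zero]
    · rw [← integral_const_mul, ← integral_sub hhi (hbi.const_mul _),
        ← integral_add_right_eq_self (fun x => h x - L / 2 * b x) L]
      congr 1
      funext s
      simp only [Pi.zero_apply, zero_add, hd, hh, hb]
      ring
    · intro s hs
      have h1 : χ (s + L) = 0 :=
        image_eq_zero_of_notMem_tsupport (f := fun s => χ (s + L)) hs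
      have h2 : deriv (fun s => χ (s + L)) s = 0 := by
        by_contra h
        exact hs (support_deriv_subset h)
      simp [h1, h2]
  rw [hlhs, hrhs, hL] at key
  have : 2 * ((∫ x, h x) + 1) / (∫ x, b x) / 2 * ∫ x, b x = (∫ x, h x) + 1 := by
    field_simp
  linarith

/-! ### A first-order linear equation solved from `+∞` -/

/-- A primitive of the integrating weight `6 + 6 s²`. -/
noncomputable def weightPrimitive (s : ℝ) : ℝ := 6 * s + 2 * s ^ 3

theorem weightPrimitive_neg (s : ℝ) : weightPrimitive (-s) = -weightPrimitive s := by
  simp only [weightPrimitive]; ring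

theorem continuous_weightPrimitive : Continuous weightPrimitive := by
  unfold weightPrimitive; fun_prop

theorem hasDerivAt_weightPrimitive (s : ℝ) : HasDerivAt weightPrimitive (6 + 6 * s ^ 2) s :=
  (((hasDerivAt_id s).const_mul 6).fun_add (((hasDerivAt_id s).fun_pow 3).const_mul 2)).congr_deriv
    (by simp; ring)

/-- The solution of `w' = (6 + 6 s²) w - f` selected by its behaviour at `+∞`. -/
noncomputable def backSolve (f : ℝ → ℝ) (s : ℝ) : ℝ :=
  Real.exp (weightPrimitive s) * ∫ t in Ioi s, Real.exp (-weightPrimitive t) * f t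

/-- `f` is a nonnegative source term for which `B` is a supersolution of
`w' = (6 + 6 s²) w - f`. -/
structure DominatedSource (f B B' : ℝ → ℝ) : Prop where
  measurable : Measurable f
  nonneg : ∀ s, 0 ≤ f s
  le : ∀ s, f s ≤ (6 + 6 * s ^ 2) * B s - B' s
  hasDerivAt : ∀ s, HasDerivAt B (B' s) s
  continuous_deriv : Continuous B'
  bound_nonneg : ∀ s, 0 ≤ B s

namespace DominatedSource

variable {f g B B' : ℝ → ℝ}

theorem bound_integrable (h : DominatedSource f B B') (s : ℝ) :
    IntegrableOn (fun t => Real.exp (-weightPrimitive t) * ((6 + 6 * t ^ 2) * B t - B' t))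
      (Ioi s) ∧
    ∫ t in Ioi s, Real.exp (-weightPrimitive t) * ((6 + 6 * t ^ 2) * B t - B' t) ≤
      Real.exp (-weightPrimitive s) * B s := by
  set G : ℝ → ℝ := fun t => Real.exp (-weightPrimitive t) * ((6 + 6 * t ^ 2) * B t - B' t) with hG
  have hBc : Continuous B := continuous_iff_continuousAt.2 fun t => (h.hasDerivAt t).continuousAt
  have hPc := continuous_weightPrimitive
  have hB'c := h.continuous_deriv
  have hGc : Continuous G := by
    simp only [hG]
    fun_prop
  have hG0 : ∀ t, 0 ≤ G t := fun t =>
    mul_nonneg (Real.exp_pos _).le ((h.nonneg t).trans (h.le t))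
  have dG : ∀ t, HasDerivAt (fun t => -(Real.exp (-weightPrimitive t) * B t)) (G t) t := fun t =>
    (((hasDerivAt_weightPrimitive t).fun_neg.exp.fun_mul (h.hasDerivAt t)).fun_neg).congr_deriv
      (by simp only [hG]; ring)
  have hle : ∀ R, ∫ t in s..R, G t ≤ Real.exp (-weightPrimitive s) * B s := fun R => by
    rw [intervalIntegral.integral_eq_sub_of_hasDerivAt (fun t _ => dG t)
      (hGc.intervalIntegrable _ _)]
    have := mul_nonneg (Real.exp_pos (-weightPrimitive R)).le (h.bound_nonneg R)
    linarith
  have hint : IntegrableOn G (Ioi s) := by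
    refine integrableOn_Ioi_of_intervalIntegral_norm_bounded (l := atTop) (b := id)
      (Real.exp (-weightPrimitive s) * B s) s (fun R => ?_) tendsto_id
      (Eventually.of_forall fun R => ?_)
    · exact (hGc.integrableOn_Icc).mono_set Ioc_subset_Icc_self
    · simpa only [Real.norm_of_nonneg (hG0 _), id] using hle R
  exact ⟨hint, le_of_tendsto (intervalIntegral_tendsto_integral_Ioi s hint tendsto_id)
    (Eventually.of_forall fun R => hle R)⟩

theorem integrableOn (h : DominatedSource f B B') (s : ℝ) :
    IntegrableOn (fun t => Real.exp (-weightPrimitive t) * f t) (Ioi s) := by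
  refine (h.bound_integrable s).1.mono' ?_ (Eventually.of_forall fun t => ?_)
  · exact ((Real.measurable_exp.comp continuous_weightPrimitive.measurable.neg).mul
      h.measurable).aestronglyMeasurable
  · rw [Real.norm_of_nonneg (mul_nonneg (Real.exp_pos _).le (h.nonneg t))]
    exact mul_le_mul_of_nonneg_left (h.le t) (Real.exp_pos _).le

theorem backSolve_nonneg (h : DominatedSource f B B') (s : ℝ) : 0 ≤ backSolve f s :=
  mul_nonneg (Real.exp_pos _).le
    (integral_nonneg fun t => mul_nonneg (Real.exp_pos _).le (h.nonneg t))

theorem backSolve_le (h : DominatedSource f B B') (s : ℝ) : backSolve f s ≤ B s := by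
  have h1 : ∫ t in Ioi s, Real.exp (-weightPrimitive t) * f t ≤
      Real.exp (-weightPrimitive s) * B s :=
    (setIntegral_mono (h.integrableOn s) (h.bound_integrable s).1 fun t =>
      mul_le_mul_of_nonneg_left (h.le t) (Real.exp_pos _).le).trans (h.bound_integrable s).2
  calc backSolve f s ≤ Real.exp (weightPrimitive s) * (Real.exp (-weightPrimitive s) * B s) :=
        mul_le_mul_of_nonneg_left h1 (Real.exp_pos _).le
    _ = B s := by rw [← mul_assoc, ← Real.exp_add]; simp

theorem backSolve_mono (hf : DominatedSource f B B') (hg : DominatedSource g B B')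
    (hfg : ∀ t, f t ≤ g t) (s : ℝ) : backSolve f s ≤ backSolve g s :=
  mul_le_mul_of_nonneg_left (setIntegral_mono (hf.integrableOn s) (hg.integrableOn s) fun t =>
    mul_le_mul_of_nonneg_left (hfg t) (Real.exp_pos _).le) (Real.exp_pos _).le

theorem backSolve_eq (h : DominatedSource f B B') : backSolve f = fun s =>
    Real.exp (weightPrimitive s) * ((∫ t in Ioi 0, Real.exp (-weightPrimitive t) * f t) -
      ∫ t in (0 : ℝ)..s, Real.exp (-weightPrimitive t) * f t) := by
  funext s
  rw [backSolve, ← intervalIntegral.integral_Ioi_sub_Ioi' (h.integrableOn 0) (h.integrableOn s)]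
  ring

theorem intervalIntegrable (h : DominatedSource f B B') (a b : ℝ) :
    IntervalIntegrable (fun t => Real.exp (-weightPrimitive t) * f t) volume a b := by
  rw [intervalIntegrable_iff]
  exact (h.integrableOn _).mono_set Ioc_subset_Ioi_self

theorem continuous_backSolve (h : DominatedSource f B B') : Continuous (backSolve f) := by
  rw [h.backSolve_eq]
  have h1 := intervalIntegral.continuous_primitive h.intervalIntegrable 0
  have h2 := continuous_weightPrimitive
  fun_prop

theorem hasDerivAt_backSolve (h : DominatedSource f B B') (hf : Continuous f) (s : ℝ) :
    HasDerivAt (backSolve f) ((6 + 6 * s ^ 2) * backSolve f s - f s) s := by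
  have hPc := continuous_weightPrimitive
  have hc : Continuous fun t => Real.exp (-weightPrimitive t) * f t := by fun_prop
  have h1 := intervalIntegral.integral_hasDerivAt_right (h.intervalIntegrable 0 s)
    (hc.stronglyMeasurableAtFilter _ _) hc.continuousAt
  have h2 := (hasDerivAt_weightPrimitive s).exp.fun_mul
    (h1.const_sub (∫ t in Ioi 0, Real.exp (-weightPrimitive t) * f t))
  rw [← h.backSolve_eq] at h2
  refine h2.congr_deriv ?_
  have h3 : Real.exp (weightPrimitive s) * Real.exp (-weightPrimitive s) = 1 := by
    rw [← Real.exp_add]; simp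
  rw [congrFun h.backSolve_eq s]
  linear_combination -f s * h3

theorem tendsto_backSolve {F : ℕ → ℝ → ℝ} (h : ∀ n, DominatedSource (F n) B B')
    (hF : ∀ t, Tendsto (fun n => F n t) atTop (𝓝 (f t))) (s : ℝ) :
    Tendsto (fun n => backSolve (F n) s) atTop (𝓝 (backSolve f s)) := by
  refine Tendsto.const_mul _ (tendsto_integral_of_dominated_convergence _
    (fun n => ((h n).integrableOn s).aestronglyMeasurable) ((h 0).bound_integrable s).1
    (fun n => Eventually.of_forall fun t => ?_)
    (Eventually.of_forall fun t => (hF t).const_mul _))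
  rw [Real.norm_of_nonneg (mul_nonneg (Real.exp_pos _).le ((h n).nonneg t))]
  exact mul_le_mul_of_nonneg_left ((h n).le t) (Real.exp_pos _).le

end DominatedSource

/-! ### Monotone iteration -/

/-- The nonlinearity of Painlevé II shifted by the linear term `((6 + 6 s²)² - 12 s) u`. -/
noncomputable def shiftedSource (s u : ℝ) : ℝ :=
  ((6 + 6 * s ^ 2) ^ 2 - 13 * s) * u - 2 * u ^ 3

theorem shiftedSource_mono {s a b : ℝ} (ha : 0 ≤ a) (hab : a ≤ b) (hb : b ≤ 2 * (1 + s ^ 2)) :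
    shiftedSource s a ≤ shiftedSource s b := by
  have hs := sq_nonneg s
  have h1 : a ^ 2 + a * b + b ^ 2 ≤ 3 * (2 * (1 + s ^ 2)) ^ 2 := by nlinarith
  have h2 : 0 ≤ (6 + 6 * s ^ 2) ^ 2 - 13 * s - 2 * (a ^ 2 + a * b + b ^ 2) := by
    nlinarith [sq_nonneg (s - 1), sq_nonneg (s ^ 2)]
  have h3 := mul_nonneg (sub_nonneg.2 hab) h2
  simp only [shiftedSource]
  linarith

/-- Measurable functions between `0` and the supersolution `2 (1 + s²)`. -/
structure Admissible (u : ℝ → ℝ) : Prop where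
  measurable : Measurable u
  nonneg : ∀ s, 0 ≤ u s
  le : ∀ s, u s ≤ 2 * (1 + s ^ 2)

/-- The inner step of the iteration, inverting one factor of
`-D² + (6 + 6 s²)² - 12 s = (-D + 6 + 6 s²) (D + 6 + 6 s²)`. -/
noncomputable def innerStep (u : ℝ → ℝ) : ℝ → ℝ := backSolve fun t => shiftedSource t (u t)

/-- One step of the monotone iteration scheme. -/
noncomputable def iterStep (u : ℝ → ℝ) (s : ℝ) : ℝ := backSolve (fun x => innerStep u (-x)) (-s)

namespace Admissible

variable {u v : ℝ → ℝ}

theorem source (hu : Admissible u) : DominatedSource (fun t => shiftedSource t (u t))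
    (fun s => 4 * s + 12 * (1 + s ^ 2) ^ 2) (fun s => 4 + 48 * s * (1 + s ^ 2)) where
  measurable := by
    have := hu.measurable
    unfold shiftedSource
    fun_prop
  nonneg s := by
    simpa [shiftedSource] using shiftedSource_mono le_rfl (hu.nonneg s) (hu.le s)
  le s := by
    refine (shiftedSource_mono (hu.nonneg s) (hu.le s) le_rfl).trans ?_
    have hs := sq_nonneg s
    have h1 : 1 + s ^ 2 ≤ (1 + s ^ 2) ^ 3 := le_self_pow₀ (by linarith) (by norm_num)
    have h2 : (1 + s ^ 2) ^ 2 ≤ (1 + s ^ 2) ^ 3 := pow_le_pow_right₀ (by linarith) (by norm_num)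
    simp only [shiftedSource]
    nlinarith [sq_nonneg (s + 1)]
  hasDerivAt s := by
    have h1 := ((hasDerivAt_id s).const_mul 4).fun_add
      (((((hasDerivAt_id s).fun_pow 2).const_add 1).fun_pow 2).const_mul 12)
    exact h1.congr_deriv (by simp; ring)
  continuous_deriv := by fun_prop
  bound_nonneg s := by nlinarith [sq_nonneg (s + 1), sq_nonneg s, sq_nonneg (s ^ 2)]

theorem source_neg (hu : Admissible u) : DominatedSource (fun x => innerStep u (-x))
    (fun s => 2 * (1 + s ^ 2)) (fun s => 4 * s) where
  measurable := (hu.source.continuous_backSolve.comp continuous_neg).measurable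
  nonneg s := hu.source.backSolve_nonneg _
  le s := (hu.source.backSolve_le _).trans_eq (by ring)
  hasDerivAt s := ((((hasDerivAt_id s).fun_pow 2).const_add 1).const_mul 2).congr_deriv
    (by simp; ring)
  continuous_deriv := by fun_prop
  bound_nonneg s := by positivity

theorem continuous_iterStep (hu : Admissible u) : Continuous (iterStep u) :=
  hu.source_neg.continuous_backSolve.comp continuous_neg

theorem iterStep (hu : Admissible u) : Admissible (iterStep u) where
  measurable := hu.continuous_iterStep.measurable
  nonneg s := hu.source_neg.backSolve_nonneg _
  le s := (hu.source_neg.backSolve_le _).trans_eq (by ring)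

theorem iterStep_mono (hu : Admissible u) (hv : Admissible v) (huv : ∀ s, u s ≤ v s) (s : ℝ) :
    _root_.iterStep u s ≤ _root_.iterStep v s :=
  hu.source_neg.backSolve_mono hv.source_neg (fun _ => hu.source.backSolve_mono hv.source
    (fun t => shiftedSource_mono (hu.nonneg t) (huv t) (hv.le t)) _) _

theorem hasDerivAt_iterStep (hu : Admissible u) (s : ℝ) : HasDerivAt (_root_.iterStep u)
    (innerStep u s - (6 + 6 * s ^ 2) * _root_.iterStep u s) s :=
  (hasDerivAt_comp_neg_of (hu.source_neg.hasDerivAt_backSolve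
    (hu.source.continuous_backSolve.comp continuous_neg) (-s))).congr_deriv
    (by simp only [_root_.iterStep, neg_neg]; ring)

theorem hasDerivAt_innerStep (hu : Admissible u) (huc : Continuous u) (s : ℝ) :
    HasDerivAt (innerStep u) ((6 + 6 * s ^ 2) * innerStep u s - shiftedSource s (u s)) s :=
  hu.source.hasDerivAt_backSolve (by unfold shiftedSource; fun_prop) s

theorem hasDerivAt_deriv_iterStep (hu : Admissible u) (huc : Continuous u) (s : ℝ) :
    HasDerivAt (fun s => innerStep u s - (6 + 6 * s ^ 2) * _root_.iterStep u s)
      (((6 + 6 * s ^ 2) ^ 2 - 12 * s) * _root_.iterStep u s - shiftedSource s (u s)) s := by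
  have h1 : HasDerivAt (fun s : ℝ => 6 + 6 * s ^ 2) (12 * s) s :=
    ((((hasDerivAt_id s).fun_pow 2).const_mul 6).const_add 6).congr_deriv (by simp; ring)
  exact ((hu.hasDerivAt_innerStep huc s).fun_sub
    (h1.fun_mul (hu.hasDerivAt_iterStep s))).congr_deriv (by ring)

theorem cos_le_iterStep (hu : Admissible u) (huc : Continuous u)
    (h : ∀ s ∈ Icc (-5 - Real.pi / 2) (-5 + Real.pi / 2), Real.cos (s + 5) ≤ u s) :
    ∀ s ∈ Icc (-5 - Real.pi / 2) (-5 + Real.pi / 2), Real.cos (s + 5) ≤ _root_.iterStep u s := by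
  intro s₀ hs₀
  have hpi := Real.pi_lt_four
  obtain ⟨x, hx, hmin⟩ := isCompact_Icc.exists_isMinOn ⟨s₀, hs₀⟩
    (f := fun s => _root_.iterStep u s - Real.cos (s + 5))
    (hu.continuous_iterStep.sub (by fun_prop)).continuousOn
  suffices hsuff : 0 ≤ _root_.iterStep u x - Real.cos (x + 5) by
    have : _root_.iterStep u x - Real.cos (x + 5) ≤ _root_.iterStep u s₀ - Real.cos (s₀ + 5) :=
      hmin hs₀
    linarith
  have hv := hu.iterStep.nonneg x
  by_contra! hneg
  have hne1 : x ≠ -5 - Real.pi / 2 := by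
    intro h
    have : Real.cos (x + 5) = 0 := by
      rw [h, show -5 - Real.pi / 2 + 5 = -(Real.pi / 2) by ring, Real.cos_neg, Real.cos_pi_div_two]
    linarith
  have hne2 : x ≠ -5 + Real.pi / 2 := by
    intro h
    have : Real.cos (x + 5) = 0 := by
      rw [h, show -5 + Real.pi / 2 + 5 = Real.pi / 2 by ring, Real.cos_pi_div_two]
    linarith
  have hloc : IsLocalMin (fun s => _root_.iterStep u s - Real.cos (s + 5)) x := hmin.isLocalMin
    (Icc_mem_nhds (lt_of_le_of_ne hx.1 (Ne.symm hne1)) (lt_of_le_of_ne hx.2 hne2))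
  have d0 : ∀ t : ℝ, HasDerivAt (fun t : ℝ => t + 5) 1 t := fun t =>
    (hasDerivAt_id t).add_const 5
  have key := second_deriv_nonneg_of_isLocalMin
    (Eventually.of_forall fun t => (hu.hasDerivAt_iterStep t).fun_sub (d0 t).cos)
    ((hu.hasDerivAt_deriv_iterStep huc x).fun_sub
      (((d0 x).sin.fun_neg.mul_const 1))) hloc
  have hc1 := Real.cos_le_one (x + 5)
  have hc0 : 0 < Real.cos (x + 5) := by linarith
  have hF := shiftedSource_mono hc0.le (h x hx) (hu.le x)
  simp only [shiftedSource] at hF key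
  have hx3 : x ≤ -3 := by linarith [hx.2]
  have hK : 0 < (6 + 6 * x ^ 2) ^ 2 - 12 * x := by nlinarith [sq_nonneg (6 + 6 * x ^ 2)]
  have h1 : ((6 + 6 * x ^ 2) ^ 2 - 12 * x) * (_root_.iterStep u x - Real.cos (x + 5)) < 0 :=
    mul_neg_of_pos_of_neg hK hneg
  have h2 : Real.cos (x + 5) * (x + 2 * Real.cos (x + 5) ^ 2 + 1) ≤ 0 :=
    mul_nonpos_of_nonneg_of_nonpos hc0.le (by nlinarith)
  linarith

theorem tendsto_iterStep {U : ℕ → ℝ → ℝ} (hU : ∀ n, Admissible (U n))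
    (h : ∀ s, Tendsto (fun n => U n s) atTop (𝓝 (u s))) (s : ℝ) :
    Tendsto (fun n => _root_.iterStep (U n) s) atTop (𝓝 (_root_.iterStep u s)) := by
  refine DominatedSource.tendsto_backSolve (fun n => (hU n).source_neg) (fun x => ?_) _
  refine DominatedSource.tendsto_backSolve (fun n => (hU n).source) (fun t => ?_) _
  exact ((h t).const_mul _).sub (((h t).pow 3).const_mul 2)

theorem painleveSol (hu : Admissible u) (hfix : _root_.iterStep u = u) : PainleveSol 0 u := by
  have huc : Continuous u := hfix ▸ hu.continuous_iterStep
  have d1 := hu.hasDerivAt_iterStep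
  have d2 := hu.hasDerivAt_deriv_iterStep huc
  rw [hfix] at d1 d2
  have hd : deriv u = fun s => innerStep u s - (6 + 6 * s ^ 2) * u s := funext fun s => (d1 s).deriv
  have hdd : deriv (deriv u) = fun s => s * u s + 2 * u s ^ 3 + 0 := funext fun s => by
    rw [hd, (d2 s).deriv, shiftedSource]
    ring
  refine ⟨?_, fun s => by rw [hdd]⟩
  rw [show (2 : WithTop ℕ∞) = 1 + 1 by norm_num, contDiff_succ_iff_deriv]
  refine ⟨fun s => (d1 s).differentiableAt, by simp, ?_⟩
  rw [contDiff_one_iff_deriv, hdd]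
  exact ⟨fun s => by rw [hd]; exact (d2 s).differentiableAt, by fun_prop⟩

end Admissible

theorem exists_pos_painleveSol : ∃ y : ℝ → ℝ, PainleveSol 0 y ∧ ∀ s, 0 < y s := by
  set U : ℕ → ℝ → ℝ := fun n => iterStep^[n] fun s => 2 * (1 + s ^ 2) with hU
  have hsucc : ∀ n, U (n + 1) = iterStep (U n) := fun n => Function.iterate_succ_apply' _ _ _
  have hadm : ∀ n, Admissible (U n) := by
    intro n
    induction n with
    | zero => exact ⟨by simp only [hU, Function.iterate_zero, id]; fun_prop,
        fun s => by simp only [hU, Function.iterate_zero, id]; positivity, fun s => le_rfl⟩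
    | succ n ih => rw [hsucc]; exact ih.iterStep
  have hcont : ∀ n, Continuous (U n) := by
    intro n
    cases n with
    | zero => simp only [hU, Function.iterate_zero, id]; fun_prop
    | succ n => rw [hsucc]; exact (hadm n).continuous_iterStep
  have hcos : ∀ n, ∀ s ∈ Icc (-5 - Real.pi / 2) (-5 + Real.pi / 2), Real.cos (s + 5) ≤ U n s := by
    intro n
    induction n with
    | zero =>
      intro s _
      simp only [hU, Function.iterate_zero, id]
      nlinarith [Real.cos_le_one (s + 5), sq_nonneg s]
    | succ n ih => rw [hsucc]; exact (hadm n).cos_le_iterStep (hcont n) ih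
  have hanti : ∀ n s, U (n + 1) s ≤ U n s := by
    intro n
    induction n with
    | zero => exact fun s => (hadm 1).le s
    | succ n ih =>
      intro s
      calc U (n + 1 + 1) s = iterStep (U (n + 1)) s := by rw [hsucc (n + 1)]
        _ ≤ iterStep (U n) s := (hadm (n + 1)).iterStep_mono (hadm n) ih s
        _ = U (n + 1) s := by rw [hsucc n]
  set y : ℝ → ℝ := fun s => ⨅ n, U n s with hy
  have hlim : ∀ s, Tendsto (fun n => U n s) atTop (𝓝 (y s)) := fun s =>
    tendsto_atTop_ciInf (antitone_nat_of_succ_le fun n => hanti n s)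
      ⟨0, by rintro _ ⟨n, rfl⟩; exact (hadm n).nonneg s⟩
  have hyadm : Admissible y :=
    ⟨measurable_of_tendsto_metrizable (fun n => (hadm n).measurable) (tendsto_pi_nhds.2 hlim),
      fun s => ge_of_tendsto' (hlim s) fun n => (hadm n).nonneg s,
      fun s => le_of_tendsto' (hlim s) fun n => (hadm n).le s⟩
  have hfix : iterStep y = y := funext fun s => by
    have h1 := Admissible.tendsto_iterStep hadm hlim s
    have h2 := (hlim s).comp (tendsto_add_atTop_nat 1)
    refine tendsto_nhds_unique h1 (h2.congr fun n => ?_)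
    rw [Function.comp, hsucc]
  have hsol := hyadm.painleveSol hfix
  refine ⟨y, hsol, hsol.pos_of_nonneg hyadm.nonneg fun h0 => ?_⟩
  have hpi := Real.pi_pos
  have h1 : Real.cos (-5 + 5) ≤ y (-5) :=
    ge_of_tendsto' (hlim (-5)) fun n => hcos n (-5) ⟨by linarith, by linarith⟩
  rw [h0] at h1
  norm_num at h1

/-- The Hastings–McLeod solution: for `α = 0`, Painlevé II has a positive, strictly decreasing
minimal solution decaying at `+∞` and asymptotic to `√(|s|/2)` at `-∞`; it is the unique
nonnegative minimal solution bounded near `+∞`. -/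
theorem stmt7 :
    ∃ y : ℝ → ℝ, MinimalSol 0 y ∧ (∀ s : ℝ, 0 < y s) ∧ (∀ s : ℝ, deriv y s < 0) ∧
      Filter.Tendsto y Filter.atTop (𝓝 0) ∧
      (∀ s : ℝ, 0 ≤ s → y s ≤ y 0 * Real.exp (-(2/3) * s ^ ((3:ℝ)/2))) ∧
      Filter.Tendsto (fun s => y s - Real.sqrt (|s| / 2)) Filter.atBot (𝓝 0) ∧
      (∀ z : ℝ → ℝ, MinimalSol 0 z → (∀ s : ℝ, 0 ≤ z s) →
        (∃ m M : ℝ, ∀ s : ℝ, m ≤ s → |z s| ≤ M) → z = y) := by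
  obtain ⟨y, hy, ypos⟩ := exists_pos_painleveSol
  refine ⟨y, hy.minimalSol ypos, ypos, hy.deriv_neg ypos, hy.tendsto_atTop ypos,
    fun s hs => hy.le_mul_exp ypos hs, hy.tendsto_sub_sqrt_atBot ypos, fun z hz hz0 _ => ?_⟩
  have hne : z ≠ 0 := fun h => not_minimalSol_zero (h ▸ hz)
  exact hy.eq_of_pos hz.1 ypos (hz.1.pos_of_nonneg hz0 hne)
end

section
/- For every α < 0, the second Painlevé equation y''(s) = s·y(s) + 2·y(s)³ + α has a minimal solution y with y(s) > 0 for all s, y'(s) < 0 for all s, s·y(s) → |α| as s → +∞ (i.e. y(s) ~ |α|/s at +∞), and y(s) − √(|s|/2) → 0 as s → −∞. -/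
open MeasureTheory Filter Topology Set


/-- At a local maximum, the second derivative is nonpositive. -/
theorem second_deriv_nonpos_of_isLocalMax_s8 {u v : ℝ → ℝ} {c x : ℝ}
    (hu : ∀ᶠ s in 𝓝 x, HasDerivAt u (v s) s) (hv : HasDerivAt v c x) (hm : IsLocalMax u x) :
    c ≤ 0 := by
  by_contra! hc
  have hv0 : v x = 0 := hm.hasDerivAt_eq_zero hu.self_of_nhds
  have hpos : ∀ᶠ s in 𝓝[>] x, 0 < v s := by
    have h1 := (hasDerivAt_iff_tendsto_slope.1 hv).eventually (lt_mem_nhds hc)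
    have h2 : ∀ᶠ s in 𝓝[>] x, 0 < slope v x s :=
      h1.filter_mono (nhdsWithin_mono _ fun s hs => ne_of_gt hs)
    filter_upwards [h2, self_mem_nhdsWithin] with s hs hxs
    rw [slope_def_field, hv0, sub_zero] at hs
    exact (div_pos_iff_of_pos_right (sub_pos.2 hxs)).1 hs
  have hall : ∀ᶠ s in 𝓝[>] x, 0 < v s ∧ HasDerivAt u (v s) s ∧ u s ≤ u x :=
    hpos.and ((hu.and hm).filter_mono nhdsWithin_le_nhds)
  obtain ⟨b, hb, hIoo⟩ := (mem_nhdsGT_iff_exists_Ioo_subset).1 hall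
  have hb' : x < b := hb
  set m := (x + b) / 2 with hmdef
  have hxm : x < m := by rw [hmdef]; linarith
  have hmb : m < b := by rw [hmdef]; linarith
  have hmono : StrictMonoOn u (Icc x m) := by
    apply strictMonoOn_of_deriv_pos (convex_Icc x m)
    · intro s hs
      rcases eq_or_lt_of_le hs.1 with h | h
      · subst h; exact hu.self_of_nhds.continuousAt.continuousWithinAt
      · exact (hIoo ⟨h, hs.2.trans_lt hmb⟩).2.1.continuousAt.continuousWithinAt
    · intro s hs
      rw [interior_Icc] at hs
      have := hIoo ⟨hs.1, hs.2.trans hmb⟩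
      rw [this.2.1.deriv]; exact this.1
  have h1 := hmono ⟨le_rfl, hxm.le⟩ ⟨hxm.le, le_rfl⟩ hxm
  exact absurd (hIoo ⟨hxm, hmb⟩).2.2 (not_le.2 h1)

/-- Comparison principle for the quotient `ρ = u / v`: it cannot have an interior maximum larger
than one if `u'' v > u v''` wherever `u > v`. -/
theorem quotient_le_of_boundary_le {u u' u'' v v' v'' ρ : ℝ → ℝ} {p q r : ℝ}
    (hρ : ContinuousOn ρ (Icc p q)) (hρu : ∀ s ∈ Ioo p q, u s = ρ s * v s)
    (hv : ∀ s ∈ Ioo p q, 0 < v s)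
    (hu1 : ∀ s ∈ Ioo p q, HasDerivAt u (u' s) s) (hu2 : ∀ s ∈ Ioo p q, HasDerivAt u' (u'' s) s)
    (hv1 : ∀ s ∈ Ioo p q, HasDerivAt v (v' s) s) (hv2 : ∀ s ∈ Ioo p q, HasDerivAt v' (v'' s) s)
    (hr : 1 ≤ r) (hp : ρ p ≤ r) (hq : ρ q ≤ r)
    (hstrict : ∀ s ∈ Ioo p q, v s < u s → u s * v'' s < u'' s * v s) :
    ∀ s ∈ Icc p q, ρ s ≤ r := by
  intro s hs
  by_contra! hlt
  obtain ⟨x, hx, hmax⟩ := isCompact_Icc.exists_isMaxOn ⟨s, hs⟩ hρ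
  have hxr : r < ρ x := hlt.trans_le (hmax hs)
  have hxI : x ∈ Ioo p q := by
    refine ⟨lt_of_le_of_ne hx.1 ?_, lt_of_le_of_ne hx.2 ?_⟩
    · rintro rfl; linarith
    · rintro rfl; linarith
  have hnhds : Ioo p q ∈ 𝓝 x := isOpen_Ioo.mem_nhds hxI
  have hvx := hv x hxI
  have h := second_deriv_nonpos_of_isLocalMax_s8 (u := fun t => u t - ρ x * v t)
    (v := fun t => u' t - ρ x * v' t) (x := x) (c := u'' x - ρ x * v'' x)
    (by filter_upwards [hnhds] with t ht using (hu1 t ht).sub ((hv1 t ht).const_mul _))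
    ((hu2 x hxI).sub ((hv2 x hxI).const_mul _))
    (by
      filter_upwards [hnhds] with t ht
      have h1 : ρ t ≤ ρ x := hmax (Ioo_subset_Icc_self ht)
      rw [hρu t ht, hρu x hxI]
      nlinarith [hv t ht])
  have h2 := hstrict x hxI (by rw [hρu x hxI]; nlinarith)
  rw [hρu x hxI] at h2
  nlinarith

/-- Maximum principle for `z'' ≥ k² z`. -/
theorem nonpos_of_deriv_ge {z z' z'' : ℝ → ℝ} {p q k : ℝ} (hk : 0 < k)
    (h1 : ∀ s, HasDerivAt z (z' s) s) (h2 : ∀ s, HasDerivAt z' (z'' s) s)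
    (hp : z p ≤ 0) (hq : z q ≤ 0) (h : ∀ s ∈ Icc p q, k ^ 2 * z s ≤ z'' s) :
    ∀ s ∈ Icc p q, z s ≤ 0 := by
  intro s hs
  by_contra! hlt
  have hc : Continuous z := continuous_iff_continuousAt.2 fun s => (h1 s).continuousAt
  obtain ⟨x, hx, hmax⟩ := isCompact_Icc.exists_isMaxOn ⟨s, hs⟩ hc.continuousOn
  have hxr : 0 < z x := hlt.trans_le (hmax hs)
  have hxI : x ∈ Ioo p q := by
    refine ⟨lt_of_le_of_ne hx.1 ?_, lt_of_le_of_ne hx.2 ?_⟩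
    · rintro rfl; linarith
    · rintro rfl; linarith
  have h3 := second_deriv_nonpos_of_isLocalMax_s8 (Eventually.of_forall h1) (h2 x)
    (hmax.isLocalMax (Icc_mem_nhds hxI.1 hxI.2))
  have h4 := h x hx
  have : 0 < k ^ 2 * z x := by positivity
  linarith

/-- Solvability of the linear Dirichlet problem `w'' = k² w + h`. -/
theorem exists_linear_dirichlet {p q k : ℝ} (hpq : p < q) (hk : 0 < k) {h : ℝ → ℝ}
    (hh : Continuous h) :
    ∃ w w' : ℝ → ℝ, (∀ s, HasDerivAt w (w' s) s) ∧
      (∀ s, HasDerivAt w' (k ^ 2 * w s + h s) s) ∧ w p = 0 ∧ w q = 0 := by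
  set A : ℝ → ℝ := fun s => ∫ t in p..s, Real.cosh (k * t) * h t
  set B : ℝ → ℝ := fun s => ∫ t in p..s, Real.sinh (k * t) * h t
  have hA : ∀ s, HasDerivAt A (Real.cosh (k * s) * h s) s := fun s =>
    (show Continuous fun t => Real.cosh (k * t) * h t by fun_prop).integral_hasStrictDerivAt p s
      |>.hasDerivAt
  have hB : ∀ s, HasDerivAt B (Real.sinh (k * s) * h s) s := fun s =>
    (show Continuous fun t => Real.sinh (k * t) * h t by fun_prop).integral_hasStrictDerivAt p s
      |>.hasDerivAt
  have hA0 : A p = 0 := intervalIntegral.integral_same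
  have hB0 : B p = 0 := intervalIntegral.integral_same
  have hlin : ∀ s, HasDerivAt (fun t => k * t) k s := fun s => by
    simpa using (hasDerivAt_id s).const_mul k
  have hlin' : ∀ s, HasDerivAt (fun t => k * (t - p)) k s := fun s => by
    simpa using ((hasDerivAt_id s).sub_const p).const_mul k
  set P : ℝ → ℝ := fun s => (Real.sinh (k * s) * A s - Real.cosh (k * s) * B s) / k
  set c : ℝ := P q / Real.sinh (k * (q - p))
  have hs0 : Real.sinh (k * (q - p)) ≠ 0 := by
    have : 0 < k * (q - p) := mul_pos hk (sub_pos.2 hpq)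
    exact (Real.sinh_pos_iff.2 this).ne'
  refine ⟨fun s => P s - c * Real.sinh (k * (s - p)),
    fun s => (Real.cosh (k * s) * A s - Real.sinh (k * s) * B s)
      - c * (Real.cosh (k * (s - p)) * k), ?_, ?_, ?_, ?_⟩
  · intro s
    have := (((((hlin s).sinh.mul (hA s)).sub ((hlin s).cosh.mul (hB s))).div_const k)).sub
      ((hlin' s).sinh.const_mul c)
    refine this.congr_deriv ?_
    field_simp
    ring
  · intro s
    have := (((hlin s).cosh.mul (hA s)).sub ((hlin s).sinh.mul (hB s))).sub
      (((hlin' s).cosh.mul_const k).const_mul c)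
    refine this.congr_deriv ?_
    simp only [P]
    have hcs := Real.cosh_sq (k * s)
    field_simp
    linear_combination h s * hcs
  · simp [P, hA0, hB0]
  · simp only [c]
    field_simp
    simp


/-- Taylor's formula of order two with integral remainder. -/
theorem eq_add_integral_of_second_deriv {w w' h : ℝ → ℝ} {p q : ℝ}
    (h1 : ∀ s ∈ Icc p q, HasDerivAt w (w' s) s) (h2 : ∀ s ∈ Icc p q, HasDerivAt w' (h s) s)
    (hh : ContinuousOn h (Icc p q)) {s : ℝ} (hs : s ∈ Icc p q) :
    w s = w p + (s - p) * w' p + ∫ t in p..s, (s - t) * h t := by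
  have hsub : uIcc p s ⊆ Icc p q := by
    rw [uIcc_of_le hs.1]; exact Icc_subset_Icc_right hs.2
  have := intervalIntegral.integral_eq_sub_of_hasDerivAt (a := p) (b := s)
    (f := fun t => w t + (s - t) * w' t) (f' := fun t => (s - t) * h t)
    (fun t ht => by
      have h3 := (h1 t (hsub ht)).add
        (((hasDerivAt_id t).const_sub s).mul (h2 t (hsub ht)))
      refine h3.congr_deriv ?_
      simp)
    (((by fun_prop : ContinuousOn (fun t => s - t) _).mul (hh.mono hsub)).intervalIntegrable)
  rw [this]
  ring

/-- A function which is a bounded pointwise limit of functions with bounded, pointwise convergent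
second derivatives, is twice differentiable, with the expected second derivative, as soon as the
limit of the second derivatives is continuous. -/
theorem second_deriv_of_tendsto {w w' g : ℕ → ℝ → ℝ} {W H : ℝ → ℝ} {p q M : ℝ} (hpq : p < q)
    (h1 : ∀ᶠ n in atTop, ∀ s ∈ Icc p q, HasDerivAt (w n) (w' n s) s)
    (h2 : ∀ᶠ n in atTop, ∀ s ∈ Icc p q, HasDerivAt (w' n) (g n s) s)
    (hg : ∀ᶠ n in atTop, ContinuousOn (g n) (Icc p q))
    (hM : ∀ᶠ n in atTop, ∀ s ∈ Icc p q, |g n s| ≤ M)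
    (hW : ∀ s ∈ Icc p q, Tendsto (fun n => w n s) atTop (𝓝 (W s)))
    (hH : ∀ s ∈ Icc p q, Tendsto (fun n => g n s) atTop (𝓝 (H s)))
    (hcont : ContinuousOn W (Icc p q) → ContinuousOn H (Icc p q)) :
    ContinuousOn W (Icc p q) ∧ ∃ W' : ℝ → ℝ, ∀ s ∈ Ioo p q,
      HasDerivAt W (W' s) s ∧ HasDerivAt W' (H s) s := by
  have hmeas : AEStronglyMeasurable H (volume.restrict (Icc p q)) := by
    obtain ⟨N, hN⟩ := eventually_atTop.1 hg
    refine aestronglyMeasurable_of_tendsto_ae atTop (f := fun n => g (n + N)) (fun n => ?_) ?_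
    · exact (hN _ (Nat.le_add_left N n)).aestronglyMeasurable measurableSet_Icc
    · filter_upwards [ae_restrict_mem measurableSet_Icc] with s hs
      exact (tendsto_add_atTop_iff_nat N).2 (hH s hs)
  have hHM : ∀ s ∈ Icc p q, |H s| ≤ M := fun s hs =>
    le_of_tendsto (hH s hs).abs (hM.mono fun n hn => hn s hs)
  have hint : IntegrableOn H (Icc p q) := by
    refine IntegrableOn.of_bound (by simp) hmeas M ?_
    filter_upwards [ae_restrict_mem measurableSet_Icc] with s hs using hHM s hs
  have hlim : ∀ s ∈ Icc p q, Tendsto (fun n => ∫ t in p..s, (s - t) * g n t) atTop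
      (𝓝 (∫ t in p..s, (s - t) * H t)) := by
    intro s hs
    have hsub : uIoc p s ⊆ Icc p q := by
      rw [uIoc_of_le hs.1]; exact fun t ht => ⟨ht.1.le, ht.2.trans hs.2⟩
    apply intervalIntegral.tendsto_integral_filter_of_dominated_convergence
      (fun _ => (q - p) * M)
    · filter_upwards [hg] with n hn
      refine ContinuousOn.aestronglyMeasurable ?_ measurableSet_uIoc
      exact (by fun_prop : ContinuousOn (fun t => s - t) _).mul (hn.mono hsub)
    · filter_upwards [hM] with n hn
      refine Eventually.of_forall fun t ht => ?_
      have ht' := hsub ht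
      rw [uIoc_of_le hs.1] at ht
      rw [Real.norm_eq_abs, abs_mul]
      refine mul_le_mul ?_ (hn t ht') (abs_nonneg _) (by linarith)
      rw [abs_of_nonneg (by linarith [ht.2])]
      linarith [hs.2, ht.1]
    · exact intervalIntegrable_const
    · exact Eventually.of_forall fun t ht => (hH t (hsub ht)).const_mul _
  have hrep : ∀ᶠ n in atTop, ∀ s ∈ Icc p q,
      w n s = w n p + (s - p) * w' n p + ∫ t in p..s, (s - t) * g n t := by
    filter_upwards [h1, h2, hg] with n a1 a2 a3 s hs
    exact eq_add_integral_of_second_deriv a1 a2 a3 hs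
  have hp : p ∈ Icc p q := left_mem_Icc.2 hpq.le
  have hq : q ∈ Icc p q := right_mem_Icc.2 hpq.le
  have hqp : q - p ≠ 0 := (sub_pos.2 hpq).ne'
  set c : ℝ := (W q - W p - ∫ t in p..q, (q - t) * H t) / (q - p)
  have hc : Tendsto (fun n => w' n p) atTop (𝓝 c) := by
    have h3 := (((hW q hq).sub (hW p hp)).sub (hlim q hq)).div_const (q - p)
    refine h3.congr' ?_
    filter_upwards [hrep] with n hn
    rw [hn q hq]
    field_simp
    ring
  have hWrep : ∀ s ∈ Icc p q, W s = W p + (s - p) * c + ∫ t in p..s, (s - t) * H t := by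
    intro s hs
    refine tendsto_nhds_unique (hW s hs) ?_
    have h3 := ((hW p hp).add (hc.const_mul (s - p))).add (hlim s hs)
    refine h3.congr' ?_
    filter_upwards [hrep] with n hn using (hn s hs).symm
  have hintt : IntegrableOn (fun t => t * H t) (Icc p q) :=
    hint.continuousOn_mul continuousOn_id isCompact_Icc
  have hsplit : ∀ G : ℝ → ℝ, IntegrableOn G (Icc p q) → ∀ s ∈ Icc p q,
      ∫ t in p..s, (s - t) * G t = s * (∫ t in p..s, G t) - ∫ t in p..s, t * G t := by
    intro G hG s hs
    have hii : ∀ F : ℝ → ℝ, IntegrableOn F (Icc p q) → IntervalIntegrable F volume p s :=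
      fun F hF => (intervalIntegrable_iff_integrableOn_Icc_of_le hs.1).2
        (hF.mono_set (Icc_subset_Icc_right hs.2))
    rw [← intervalIntegral.integral_const_mul, ← intervalIntegral.integral_sub
      ((hii G hG).const_mul s) (hii (fun t => t * G t) (hG.continuousOn_mul continuousOn_id isCompact_Icc))]
    exact intervalIntegral.integral_congr fun t _ => by ring
  have hWcont : ContinuousOn W (Icc p q) := by
    have hprim : ∀ F : ℝ → ℝ, IntegrableOn F (Icc p q) →
        ContinuousOn (fun s => ∫ t in p..s, F t) (Icc p q) := fun F hF => by
      have := intervalIntegral.continuousOn_primitive_interval (μ := volume) (f := F)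
        (a := p) (b := q) (by rwa [uIcc_of_le hpq.le])
      rwa [uIcc_of_le hpq.le] at this
    have h3 : ContinuousOn (fun s => W p + (s - p) * c +
        (s * (∫ t in p..s, H t) - ∫ t in p..s, t * H t)) (Icc p q) :=
      (by fun_prop : ContinuousOn (fun s => W p + (s - p) * c) (Icc p q)).add
        ((continuousOn_id.mul (hprim H hint)).sub (hprim _ hintt))
    refine h3.congr fun s hs => ?_
    rw [hWrep s hs, hsplit H hint s hs]
  refine ⟨hWcont, ?_⟩
  have hHc := hcont hWcont
  set G : ℝ → ℝ := IccExtend hpq.le ((Icc p q).domRestrict H) with hG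
  have hGc : Continuous G := (continuousOn_iff_continuous_domRestrict.1 hHc).Icc_extend'
  have hGH : ∀ s ∈ Icc p q, G s = H s := fun s hs => by
    rw [hG, IccExtend_of_mem hpq.le _ hs]; rfl
  have hd1 : ∀ s, HasDerivAt (fun s => ∫ t in p..s, G t) (G s) s := fun s =>
    (hGc.integral_hasStrictDerivAt p s).hasDerivAt
  have hd2 : ∀ s, HasDerivAt (fun s => ∫ t in p..s, t * G t) (s * G s) s := fun s =>
    ((continuous_id.mul hGc).integral_hasStrictDerivAt p s).hasDerivAt
  refine ⟨fun s => c + ∫ t in p..s, G t, fun s hs => ⟨?_, ?_⟩⟩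
  · have hrepG : ∀ x ∈ Icc p q,
        W x = W p + (x - p) * c + (x * (∫ t in p..x, G t) - ∫ t in p..x, t * G t) := by
      intro x hx
      rw [hWrep x hx, ← hsplit G (hGc.continuousOn.integrableOn_Icc) x hx]
      congr 1
      refine intervalIntegral.integral_congr fun t ht => ?_
      rw [uIcc_of_le hx.1] at ht
      simp only [hGH t ⟨ht.1, ht.2.trans hx.2⟩]
    have h3 := ((((hasDerivAt_id s).sub_const p).mul_const c).const_add (W p)).add
      (((hasDerivAt_id s).mul (hd1 s)).sub (hd2 s))
    refine (h3.congr_of_eventuallyEq ?_).congr_deriv ?_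
    · filter_upwards [isOpen_Ioo.mem_nhds hs] with x hx
      exact hrepG x (Ioo_subset_Icc_self hx)
    · simp only [id]; ring
  · rw [← hGH s (Ioo_subset_Icc_self hs)]
    exact (hd1 s).const_add c


/-- The nonlinearity of Painlevé II becomes decreasing in `x ∈ [0, C]` after subtracting
`(3 C)² x`. -/
theorem painleve_sub_le {s x y C a : ℝ} (hC : 1 ≤ C) (hs : s ≤ C) (hx : 0 ≤ x) (hxy : x ≤ y)
    (hy : y ≤ C) :
    s * y + 2 * y ^ 3 - a - (3 * C) ^ 2 * y ≤ s * x + 2 * x ^ 3 - a - (3 * C) ^ 2 * x := by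
  have h1 : 0 ≤ y - x := sub_nonneg.2 hxy
  have h2 : 0 ≤ (3 * C) ^ 2 - s - 2 * (x ^ 2 + x * y + y ^ 2) := by
    have hy0 : 0 ≤ y := hx.trans hxy
    have e1 : y ^ 2 ≤ C ^ 2 := pow_le_pow_left₀ hy0 hy 2
    have e2 : x ^ 2 ≤ C ^ 2 := pow_le_pow_left₀ hx (hxy.trans hy) 2
    have e3 : x * y ≤ C * C := mul_le_mul (hxy.trans hy) hy hy0 (by linarith)
    nlinarith
  nlinarith [mul_nonneg h1 h2]

/-- Positive solutions of the Painlevé II equation on `[-N, N]` vanishing at the end points. -/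
theorem exists_painleve_dirichlet {a N : ℝ} (ha : 0 < a) (hN : 0 < N) :
    ∃ u v : ℝ → ℝ, ContinuousOn u (Icc (-N) N) ∧
      (∀ s ∈ Ioo (-N) N, HasDerivAt u (v s) s ∧ HasDerivAt v (s * u s + 2 * u s ^ 3 - a) s) ∧
      u (-N) = 0 ∧ u N = 0 ∧ ∀ s ∈ Ioo (-N) N, 0 < u s := by
  obtain ⟨C, hCdef⟩ : ∃ C, C = N + a + 1 := ⟨_, rfl⟩
  have hC1 : 1 ≤ C := by linarith
  have hNN : -N < N := by linarith
  have hk : 0 < 3 * C := by linarith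
  have hsC : ∀ s ∈ Icc (-N) N, s ≤ C := fun s hs => by linarith [hs.2]
  have hex : ∀ u : C(ℝ, ℝ), ∃ w : C(ℝ, ℝ), ∃ w' : ℝ → ℝ, (∀ s, HasDerivAt w (w' s) s) ∧
      (∀ s, HasDerivAt w' ((3 * C) ^ 2 * w s + (s * u s + 2 * u s ^ 3 - a - (3 * C) ^ 2 * u s)) s)
      ∧ w (-N) = 0 ∧ w N = 0 := by
    intro u
    obtain ⟨w, w', h1, h2, h3, h4⟩ := exists_linear_dirichlet hNN hk
      (h := fun s => s * u s + 2 * u s ^ 3 - a - (3 * C) ^ 2 * u s) (by fun_prop)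
    exact ⟨⟨w, continuous_iff_continuousAt.2 fun s => (h1 s).continuousAt⟩, w', h1, h2, h3, h4⟩
  choose T T' hT1 hT2 hTl hTr using hex
  have hT_nonneg : ∀ s ∈ Icc (-N) N, 0 ≤ T 0 s := by
    intro s hs
    have := nonpos_of_deriv_ge hk (fun s => (hT1 0 s).neg) (fun s => (hT2 0 s).neg)
      (by simp [hTl]) (by simp [hTr])
      (fun s _ => by simp only [ContinuousMap.zero_apply, Pi.neg_apply]; nlinarith) s hs
    simpa using this
  have hT_mono : ∀ u₁ u₂ : C(ℝ, ℝ), (∀ s ∈ Icc (-N) N, 0 ≤ u₁ s ∧ u₁ s ≤ u₂ s ∧ u₂ s ≤ C) →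
      ∀ s ∈ Icc (-N) N, T u₁ s ≤ T u₂ s := by
    intro u₁ u₂ h s hs
    have := nonpos_of_deriv_ge hk (fun s => (hT1 u₁ s).sub (hT1 u₂ s))
      (fun s => (hT2 u₁ s).sub (hT2 u₂ s)) (by simp [hTl]) (by simp [hTr])
      (fun s hs => by
        obtain ⟨h1, h2, h3⟩ := h s hs
        have := painleve_sub_le (a := a) hC1 (hsC s hs) h1 h2 h3
        simp only [Pi.sub_apply]
        linarith) s hs
    simpa using this
  have hT_le : ∀ u : C(ℝ, ℝ), (∀ s ∈ Icc (-N) N, 0 ≤ u s ∧ u s ≤ C) →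
      ∀ s ∈ Icc (-N) N, T u s ≤ C := by
    intro u h s hs
    have := nonpos_of_deriv_ge hk (fun s => (hT1 u s).sub_const C)
      (fun s => hT2 u s) (by simp only [hTl]; linarith) (by simp only [hTr]; linarith)
      (fun s hs => by
        obtain ⟨h1, h2⟩ := h s hs
        have h3 := painleve_sub_le (a := a) hC1 (hsC s hs) h1 h2 le_rfl
        have h4 : 0 ≤ s * C + 2 * C ^ 3 - a := by
          have : C ≤ s + 2 * C ^ 2 := by nlinarith [hs.1]
          nlinarith
        linarith) s hs
    linarith
  let U : ℕ → C(ℝ, ℝ) := fun n => T^[n] 0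
  have hUsucc : ∀ n, U (n + 1) = T (U n) := fun n => Function.iterate_succ_apply' T n 0
  have hU : ∀ n, ∀ s ∈ Icc (-N) N, 0 ≤ U n s ∧ U n s ≤ U (n + 1) s ∧ U (n + 1) s ≤ C := by
    intro n
    induction n with
    | zero =>
      intro s hs
      refine ⟨le_rfl, hT_nonneg s hs, ?_⟩
      exact hT_le 0 (fun s _ => ⟨le_rfl, by simp only [ContinuousMap.zero_apply]; linarith⟩) s hs
    | succ n ih =>
      intro s hs
      refine ⟨(ih s hs).1.trans (ih s hs).2.1, ?_, ?_⟩
      · rw [hUsucc (n + 1), hUsucc n]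
        have := hT_mono (U n) (U (n + 1)) ih s hs
        rwa [hUsucc n] at this
      · rw [hUsucc (n + 1)]
        exact hT_le _ (fun s hs => ⟨(ih s hs).1.trans (ih s hs).2.1, (ih s hs).2.2⟩) s hs
  have hUC : ∀ n, ∀ s ∈ Icc (-N) N, U n s ≤ C := fun n s hs => (hU n s hs).2.1.trans (hU n s hs).2.2
  let W : ℝ → ℝ := fun s => ⨆ n, U n s
  have hlim : ∀ s ∈ Icc (-N) N, Tendsto (fun n => U n s) atTop (𝓝 (W s)) := fun s hs =>
    tendsto_atTop_ciSup (monotone_nat_of_le_succ fun n => (hU n s hs).2.1)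
      ⟨C, by rintro _ ⟨n, rfl⟩; exact hUC n s hs⟩
  have hlim' : ∀ s ∈ Icc (-N) N, Tendsto (fun n => U (n + 1) s) atTop (𝓝 (W s)) := fun s hs =>
    (tendsto_add_atTop_iff_nat 1).2 (hlim s hs)
  obtain ⟨hWc, W', hW'⟩ := second_deriv_of_tendsto hNN (w := fun n => U (n + 1))
    (w' := fun n => T' (U n)) (W := W)
    (g := fun n s => (3 * C) ^ 2 * U (n + 1) s +
      (s * U n s + 2 * U n s ^ 3 - a - (3 * C) ^ 2 * U n s))
    (H := fun s => s * W s + 2 * W s ^ 3 - a)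
    (M := (3 * C) ^ 2 * C + (N * C + 2 * C ^ 3 + a + (3 * C) ^ 2 * C))
    (Eventually.of_forall fun n s _ => by simp only [hUsucc]; exact hT1 _ s)
    (Eventually.of_forall fun n s _ => by simp only [hUsucc]; exact hT2 _ s)
    (Eventually.of_forall fun n => by fun_prop)
    (Eventually.of_forall fun n s hs => by
      obtain ⟨h1, h2, h3⟩ := hU n s hs
      have h4 := h2.trans h3
      have e1 : U n s ^ 3 ≤ C ^ 3 := pow_le_pow_left₀ h1 h4 3
      have e2 : 0 ≤ U n s ^ 3 := pow_nonneg h1 3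
      have e3 : |s * U n s| ≤ N * C := by
        rw [abs_mul, abs_of_nonneg h1]
        exact mul_le_mul (abs_le.2 hs) h4 h1 hN.le
      have e4 : (3 * C) ^ 2 * U n s ≤ (3 * C) ^ 2 * C := by gcongr
      have e5 : (3 * C) ^ 2 * U (n + 1) s ≤ (3 * C) ^ 2 * C := by gcongr
      have e6 : 0 ≤ (3 * C) ^ 2 * U n s := by positivity
      have e7 : 0 ≤ (3 * C) ^ 2 * U (n + 1) s := mul_nonneg (sq_nonneg _) (h1.trans h2)
      obtain ⟨e8, e9⟩ := abs_le.1 e3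
      refine abs_le.2 ⟨?_, ?_⟩ <;> linarith)
    hlim'
    (fun s hs => by
      have h1 := ((hlim' s hs).const_mul ((3 * C) ^ 2)).add
        ((((hlim s hs).const_mul s).add (((hlim s hs).pow 3).const_mul 2)).sub_const a |>.sub
          ((hlim s hs).const_mul ((3 * C) ^ 2)))
      refine h1.trans_eq ?_
      congr 1
      ring)
    (fun h => by fun_prop)
  have hnonneg : ∀ s ∈ Icc (-N) N, 0 ≤ W s := fun s hs =>
    ge_of_tendsto' (hlim s hs) fun n => (hU n s hs).1
  refine ⟨W, W', hWc, hW', ?_, ?_, ?_⟩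
  · exact tendsto_nhds_unique (hlim' _ (left_mem_Icc.2 hNN.le)) (by simp [hUsucc, hTl])
  · exact tendsto_nhds_unique (hlim' _ (right_mem_Icc.2 hNN.le)) (by simp [hUsucc, hTr])
  · intro s hs
    refine lt_of_le_of_ne (hnonneg s (Ioo_subset_Icc_self hs)) fun h0 => ?_
    have hn : Ioo (-N) N ∈ 𝓝 s := isOpen_Ioo.mem_nhds hs
    have h2 := second_deriv_nonpos_of_isLocalMax_s8 (u := fun t => -W t) (v := fun t => -W' t)
      (by filter_upwards [hn] with t ht using (hW' t ht).1.neg) (hW' s hs).2.neg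
      (by
        filter_upwards [hn] with t ht
        rw [← h0]
        simpa using hnonneg t (Ioo_subset_Icc_self ht))
    rw [← h0] at h2
    linarith


theorem cos_pi_div_two_mul_pos {s c : ℝ} (hs : s ∈ Ioo (c - 1) (c + 1)) :
    0 < Real.cos (Real.pi / 2 * (s - c)) := by
  refine Real.cos_pos_of_mem_Ioo ⟨?_, ?_⟩ <;> nlinarith [Real.pi_pos, hs.1, hs.2]

/-- Universal local upper bound for nonnegative solutions, by comparison with
`K / cos (π (s - c) / 2)`. -/
theorem painleve_le_of_window {u v : ℝ → ℝ} {a c K : ℝ} (ha : 0 < a)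
    (hu : ContinuousOn u (Icc (c - 1) (c + 1)))
    (h : ∀ s ∈ Ioo (c - 1) (c + 1),
      HasDerivAt u (v s) s ∧ HasDerivAt v (s * u s + 2 * u s ^ 3 - a) s)
    (hK : 1 ≤ K) (hKω : (Real.pi / 2) ^ 2 ≤ K ^ 2)
    (hKc : 1 + a - c ≤ 2 * K ^ 2 - 2 * (Real.pi / 2) ^ 2) : u c ≤ K := by
  obtain ⟨ω, hω⟩ : ∃ ω, ω = Real.pi / 2 := ⟨_, rfl⟩
  have hcos : ∀ s ∈ Ioo (c - 1) (c + 1), 0 < Real.cos (ω * (s - c)) := fun s hs => by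
    rw [hω]; exact cos_pi_div_two_mul_pos hs
  have hK0 : 0 < K := by linarith
  rw [← hω] at hKω hKc
  have hlin : ∀ s, HasDerivAt (fun t => ω * (t - c)) ω s := fun s => by
    simpa using ((hasDerivAt_id s).sub_const c).const_mul ω
  have := quotient_le_of_boundary_le (u := u) (u' := v)
    (u'' := fun s => s * u s + 2 * u s ^ 3 - a)
    (v := fun s => K / Real.cos (ω * (s - c)))
    (v' := fun s => K * ω * Real.sin (ω * (s - c)) / Real.cos (ω * (s - c)) ^ 2)
    (v'' := fun s => K * ω ^ 2 * (2 / Real.cos (ω * (s - c)) ^ 3 - 1 / Real.cos (ω * (s - c))))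
    (ρ := fun s => u s * Real.cos (ω * (s - c)) / K) (p := c - 1) (q := c + 1) (r := 1)
    (by fun_prop)
    (fun s hs => by have := (hcos s hs).ne'; field_simp)
    (fun s hs => div_pos hK0 (hcos s hs))
    (fun s hs => (h s hs).1) (fun s hs => (h s hs).2)
    (fun s hs => by
      have h0 := (hcos s hs).ne'
      refine ((hasDerivAt_const s K).div (hlin s).cos h0).congr_deriv ?_
      field_simp
      ring)
    (fun s hs => by
      have h0 := (hcos s hs).ne'
      have h1 := ((hlin s).sin.const_mul (K * ω)).div ((hlin s).cos.pow 2) (pow_ne_zero 2 h0)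
      refine h1.congr_deriv ?_
      have h2 := Real.sin_sq (ω * (s - c))
      field_simp
      simp only [Nat.cast_ofNat, Nat.add_one_sub_one, pow_one, Pi.pow_apply]
      ring_nf
      rw [show Real.sin (ω * s - ω * c) = Real.sin (ω * (s - c)) by ring_nf, h2]
      ring_nf)
    le_rfl
    (by
      have : Real.cos (ω * (c - 1 - c)) = 0 := by
        rw [show ω * (c - 1 - c) = -(Real.pi / 2) by rw [hω]; ring]; simp
      simp only [this, mul_zero, zero_div, zero_le_one])
    (by
      have : Real.cos (ω * (c + 1 - c)) = 0 := by
        rw [show ω * (c + 1 - c) = Real.pi / 2 by rw [hω]; ring]; simp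
      simp only [this, mul_zero, zero_div, zero_le_one])
    (fun s hs hlt => by
      have hx := hcos s hs
      have hx1 := Real.cos_le_one (ω * (s - c))
      set x := Real.cos (ω * (s - c))
      have hKx : 0 < K / x := div_pos hK0 hx
      have hu1 : 1 < u s := by
        have : K ≤ K / x := by rw [le_div_iff₀ hx]; nlinarith
        linarith
      have hX : 1 ≤ 1 / x ^ 2 := by
        rw [le_div_iff₀ (by positivity)]; nlinarith
      have hu2 : K ^ 2 * (1 / x ^ 2) < u s ^ 2 := by
        have := pow_lt_pow_left₀ hlt hKx.le two_ne_zero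
        rw [div_pow] at this
        rw [mul_one_div]; exact this
      have e1 : u s * (K * ω ^ 2 * (2 / x ^ 3 - 1 / x))
          = (K / x) * (u s * (ω ^ 2 * (2 * (1 / x ^ 2) - 1))) := by
        field_simp
      rw [e1, mul_comm _ (K / x)]
      apply mul_lt_mul_of_pos_left _ hKx
      have e2 : ω ^ 2 * (2 * (1 / x ^ 2) - 1) < s + 2 * u s ^ 2 - a := by
        nlinarith [hs.1, sq_nonneg ω]
      have e3 := mul_lt_mul_of_pos_left e2 (by linarith : (0:ℝ) < u s)
      nlinarith)
  have h2 := this c ⟨by linarith, by linarith⟩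
  simpa [div_le_one hK0] using h2

/-- Local lower bound for positive solutions, by comparison with `k cos (π (s - c) / 2)`. -/
theorem le_painleve_of_window {u v : ℝ → ℝ} {a c k : ℝ} (ha : 0 < a)
    (h : ∀ s, HasDerivAt u (v s) s ∧ HasDerivAt v (s * u s + 2 * u s ^ 3 - a) s)
    (hpos : ∀ s, 0 < u s) (hk : 0 < k) (hkc : c + 1 + 2 * k ^ 2 + (Real.pi / 2) ^ 2 ≤ a / k) :
    k ≤ u c := by
  obtain ⟨ω, hω⟩ : ∃ ω, ω = Real.pi / 2 := ⟨_, rfl⟩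
  have hcos : ∀ s ∈ Ioo (c - 1) (c + 1), 0 < Real.cos (ω * (s - c)) := fun s hs => by
    rw [hω]; exact cos_pi_div_two_mul_pos hs
  rw [← hω] at hkc
  have huc : Continuous u := continuous_iff_continuousAt.2 fun s => (h s).1.continuousAt
  have hlin : ∀ s, HasDerivAt (fun t => ω * (t - c)) ω s := fun s => by
    simpa using ((hasDerivAt_id s).sub_const c).const_mul ω
  have := quotient_le_of_boundary_le (v := u) (v' := v)
    (v'' := fun s => s * u s + 2 * u s ^ 3 - a)
    (u := fun s => k * Real.cos (ω * (s - c)))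
    (u' := fun s => k * (-Real.sin (ω * (s - c)) * ω))
    (u'' := fun s => k * (-(Real.cos (ω * (s - c)) * ω) * ω))
    (ρ := fun s => k * Real.cos (ω * (s - c)) / u s) (p := c - 1) (q := c + 1) (r := 1)
    (ContinuousOn.div (by fun_prop) huc.continuousOn fun s _ => (hpos s).ne')
    (fun s _ => by have := (hpos s).ne'; field_simp)
    (fun s _ => hpos s)
    (fun s _ => (hlin s).cos.const_mul k)
    (fun s _ => ((hlin s).sin.neg.mul_const ω).const_mul k)
    (fun s _ => (h s).1) (fun s _ => (h s).2)
    le_rfl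
    (by
      have : Real.cos (ω * (c - 1 - c)) = 0 := by
        rw [show ω * (c - 1 - c) = -(Real.pi / 2) by rw [hω]; ring]; simp
      simp only [this, mul_zero, zero_div, zero_le_one])
    (by
      have : Real.cos (ω * (c + 1 - c)) = 0 := by
        rw [show ω * (c + 1 - c) = Real.pi / 2 by rw [hω]; ring]; simp
      simp only [this, mul_zero, zero_div, zero_le_one])
    (fun s hs hlt => by
      have hx := hcos s hs
      have hx1 := Real.cos_le_one (ω * (s - c))
      set x := Real.cos (ω * (s - c))
      have hkx : 0 < k * x := mul_pos hk hx
      have huk : u s < k := hlt.trans_le (by nlinarith)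
      have hu := hpos s
      have e1 : k * (-(x * ω) * ω) * u s = (k * x) * (-(ω ^ 2 * u s)) := by ring
      rw [e1]
      apply mul_lt_mul_of_pos_left _ hkx
      have e2 : s + 2 * u s ^ 2 + ω ^ 2 < a / k := by
        have : u s ^ 2 < k ^ 2 := pow_lt_pow_left₀ huk hu.le two_ne_zero
        linarith [hs.2]
      rw [lt_div_iff₀ hk] at e2
      by_cases h0 : 0 ≤ s + 2 * u s ^ 2 + ω ^ 2
      · nlinarith [mul_le_mul_of_nonneg_left huk.le h0]
      · nlinarith [mul_pos hu (neg_pos.2 (not_le.1 h0))])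
  have h2 := this c ⟨by linarith, by linarith⟩
  have h3 : k / u c ≤ 1 := by simpa using h2
  rwa [div_le_one (hpos c)] at h3

/-- Local upper bound for positive solutions on large windows, by comparison with
`κ (1 + (s - c) ^ 4)`. -/
theorem painleve_le_of_large_window {u v : ℝ → ℝ} {a c R κ : ℝ} (ha : 0 < a)
    (h : ∀ s, HasDerivAt u (v s) s ∧ HasDerivAt v (s * u s + 2 * u s ^ 3 - a) s)
    (hR : 0 ≤ R) (hκ : 0 < κ) (hκc : a / κ ≤ c - R - 6)
    (hl : u (c - R) ≤ κ * (1 + R ^ 4)) (hr : u (c + R) ≤ κ * (1 + R ^ 4)) : u c ≤ κ := by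
  have huc : Continuous u := continuous_iff_continuousAt.2 fun s => (h s).1.continuousAt
  have hB : ∀ s, 0 < κ * (1 + (s - c) ^ 4) := fun s => by positivity
  have := quotient_le_of_boundary_le (u := u) (u' := v)
    (u'' := fun s => s * u s + 2 * u s ^ 3 - a)
    (v := fun s => κ * (1 + (s - c) ^ 4))
    (v' := fun s => κ * (4 * (s - c) ^ 3))
    (v'' := fun s => κ * (12 * (s - c) ^ 2))
    (ρ := fun s => u s / (κ * (1 + (s - c) ^ 4))) (p := c - R) (q := c + R) (r := 1)
    (ContinuousOn.div huc.continuousOn (by fun_prop) fun s _ => (hB s).ne')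
    (fun s _ => by rw [div_mul_cancel₀ _ (hB s).ne'])
    (fun s _ => hB s)
    (fun s _ => (h s).1) (fun s _ => (h s).2)
    (fun s _ => by
      have := ((((hasDerivAt_id s).sub_const c).pow 4).const_add 1).const_mul κ
      refine this.congr_deriv ?_
      simp)
    (fun s _ => by
      have := ((((hasDerivAt_id s).sub_const c).pow 3).const_mul 4).const_mul κ
      refine this.congr_deriv ?_
      simp only [id, Nat.cast_ofNat, Nat.add_one_sub_one, mul_one]
      ring)
    le_rfl
    (by rw [div_le_one (hB _), show (c - R - c) ^ 4 = R ^ 4 by ring]; exact hl)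
    (by rw [div_le_one (hB _), show (c + R - c) ^ 4 = R ^ 4 by ring]; exact hr)
    (fun s hs hlt => by
      set x := s - c
      have hx : 0 < 1 + x ^ 4 := by positivity
      have huκ : κ < u s := by
        nlinarith [mul_nonneg hκ.le (by positivity : 0 ≤ x ^ 4)]
      have hu : 0 < u s := hκ.trans huκ
      rw [div_le_iff₀ hκ] at hκc
      have h0 : 0 ≤ c - R - 6 := by
        by_contra! hneg
        nlinarith
      have e1 : 6 * u s < s * u s + 2 * u s ^ 3 - a := by
        nlinarith [hs.1, pow_pos hu 3, mul_le_mul_of_nonneg_left huκ.le h0]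
      have e2 : 12 * x ^ 2 ≤ 6 * (1 + x ^ 4) := by nlinarith [sq_nonneg (x ^ 2 - 1)]
      calc u s * (κ * (12 * x ^ 2)) ≤ u s * (κ * (6 * (1 + x ^ 4))) := by gcongr
        _ = 6 * u s * (κ * (1 + x ^ 4)) := by ring
        _ < (s * u s + 2 * u s ^ 3 - a) * (κ * (1 + x ^ 4)) := by gcongr)
  have h2 := this c ⟨by linarith, by linarith⟩
  simpa [div_le_one hκ] using h2


/-- Two nonnegative solutions on `[p, q]`, the first one vanishing at the end points, are
ordered. -/
theorem painleve_le_of_dirichlet {u u' v v' : ℝ → ℝ} {a p q : ℝ} (ha : 0 < a)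
    (hu : ∀ s ∈ Ioo p q, HasDerivAt u (u' s) s ∧ HasDerivAt u' (s * u s + 2 * u s ^ 3 - a) s)
    (hv : ∀ s ∈ Ioo p q, HasDerivAt v (v' s) s ∧ HasDerivAt v' (s * v s + 2 * v s ^ 3 - a) s)
    (huc : ContinuousOn u (Icc p q)) (hvc : ContinuousOn v (Icc p q))
    (hpos : ∀ s ∈ Icc p q, 0 < v s) (hp : u p = 0) (hq : u q = 0) :
    ∀ s ∈ Icc p q, u s ≤ v s := by
  intro s hs
  have := quotient_le_of_boundary_le (ρ := fun s => u s / v s) (r := 1)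
    (huc.div hvc fun s hs => (hpos s hs).ne')
    (fun s hs => by rw [div_mul_cancel₀ _ (hpos s (Ioo_subset_Icc_self hs)).ne'])
    (fun s hs => hpos s (Ioo_subset_Icc_self hs))
    (fun s hs => (hu s hs).1) (fun s hs => (hu s hs).2)
    (fun s hs => (hv s hs).1) (fun s hs => (hv s hs).2) le_rfl (by simp [hp]) (by simp [hq])
    (fun s hs hlt => by
      have hb := hpos s (Ioo_subset_Icc_self hs)
      have h1 : 0 < u s - v s := sub_pos.2 hlt
      have h2 : 0 < u s := hb.trans hlt
      have h3 : 0 < 2 * (u s * v s * ((u s - v s) * (u s + v s))) + a * (u s - v s) := by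
        positivity
      linarith) s hs
  exact (div_le_one (hpos s hs)).1 this

/-- Painlevé II with `α = -a < 0` has a positive solution on the whole line. -/
theorem exists_pos_painleve {a : ℝ} (ha : 0 < a) :
    ∃ y v : ℝ → ℝ,
      (∀ s, HasDerivAt y (v s) s ∧ HasDerivAt v (s * y s + 2 * y s ^ 3 - a) s) ∧
      ∀ s, 0 < y s := by
  have hN : ∀ n : ℕ, (0:ℝ) < n + 1 := fun n => by positivity
  choose u v huc hd hl hr hpos using fun n : ℕ => exists_painleve_dirichlet ha (hN n)
  let I : ℕ → Set ℝ := fun n => Ioo (-((n:ℝ) + 1)) (n + 1)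
  let U : ℕ → ℝ → ℝ := fun n => (I n).indicator (u n)
  have hIsub : ∀ n : ℕ, Icc (-((n:ℝ) + 1)) (n + 1) ⊆ I (n + 1) := fun n s hs => by
    constructor <;> push_cast <;> linarith [hs.1, hs.2]
  have hII : ∀ n, I n ⊆ I (n + 1) := fun n => Ioo_subset_Icc_self.trans (hIsub n)
  have hmono : Monotone U := by
    refine monotone_nat_of_le_succ fun n s => ?_
    by_cases hs : s ∈ I n
    · simp only [U]
      rw [indicator_of_mem hs, indicator_of_mem (hII n hs)]
      exact painleve_le_of_dirichlet ha (hd n) (fun s hs => hd (n + 1) s (hII n hs)) (huc n)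
        ((huc (n + 1)).mono ((hIsub n).trans Ioo_subset_Icc_self))
        (fun s hs => hpos (n + 1) s (hIsub n hs)) (hl n) (hr n) s (Ioo_subset_Icc_self hs)
    · simp only [U]
      rw [indicator_of_notMem hs]
      exact indicator_nonneg (fun s hs => (hpos (n + 1) s hs).le) s
  have hImem : ∀ (m n : ℕ) (s : ℝ), m ≤ n → s ∈ Icc (-(m:ℝ)) m → s ∈ I n := by
    intro m n s hmn hs
    have : (m:ℝ) ≤ n := by exact_mod_cast hmn
    constructor <;> linarith [hs.1, hs.2]
  have hbound : ∀ (m n : ℕ) (s : ℝ), s ∈ Icc (-(m:ℝ)) m → U n s ≤ m + a + 4 := by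
    intro m n s hs
    have h1 : U n s ≤ U (max n (m + 1)) s := hmono (le_max_left _ _) s
    refine h1.trans ?_
    set k := max n (m + 1)
    have hk : m + 1 ≤ k := le_max_right _ _
    have hk' : (m:ℝ) + 1 ≤ k := by exact_mod_cast hk
    have hsub : Icc (s - 1) (s + 1) ⊆ I k := fun t ht => by
      constructor <;> linarith [ht.1, ht.2, hs.1, hs.2]
    have hsk : s ∈ I k := hsub ⟨by linarith, by linarith⟩
    simp only [U]
    rw [indicator_of_mem hsk]
    have hm : (0:ℝ) ≤ m := by positivity
    have hπ : (Real.pi / 2) ^ 2 ≤ 4 := by nlinarith [Real.pi_pos, Real.pi_le_four]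
    exact painleve_le_of_window ha ((huc k).mono (hsub.trans Ioo_subset_Icc_self))
      (fun t ht => hd k t (hsub (Ioo_subset_Icc_self ht))) (by linarith) (by nlinarith)
      (by nlinarith [hs.1])
  have hex : ∀ s : ℝ, ∃ m : ℕ, 1 ≤ m ∧ s ∈ Ioo (-(m:ℝ)) m := fun s => by
    obtain ⟨m, hm⟩ := exists_nat_gt |s|
    refine ⟨m + 1, by omega, ?_⟩
    push_cast
    have := abs_lt.1 hm
    exact ⟨by linarith, by linarith⟩
  let y : ℝ → ℝ := fun s => ⨆ n, U n s
  have hbdd : ∀ s, BddAbove (range fun n => U n s) := fun s => by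
    obtain ⟨m, _, hm⟩ := hex s
    exact ⟨m + a + 4, by rintro _ ⟨n, rfl⟩; exact hbound m n s (Ioo_subset_Icc_self hm)⟩
  have hlimU : ∀ s, Tendsto (fun n => U n s) atTop (𝓝 (y s)) := fun s =>
    tendsto_atTop_ciSup (fun i j hij => hmono hij s) (hbdd s)
  have hlim : ∀ s, Tendsto (fun n => u n s) atTop (𝓝 (y s)) := fun s => by
    obtain ⟨m, _, hm⟩ := hex s
    refine (hlimU s).congr' ?_
    filter_upwards [eventually_ge_atTop m] with n hn
    exact indicator_of_mem (hImem m n s hn (Ioo_subset_Icc_self hm)) _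
  have hloc : ∀ m : ℕ, 1 ≤ m → ∃ W' : ℝ → ℝ, ∀ s ∈ Ioo (-(m:ℝ)) m,
      HasDerivAt y (W' s) s ∧ HasDerivAt W' (s * y s + 2 * y s ^ 3 - a) s := by
    intro m hm
    have hm' : (1:ℝ) ≤ m := by exact_mod_cast hm
    have hev : ∀ᶠ n : ℕ in atTop, ∀ s ∈ Icc (-(m:ℝ)) m, s ∈ I n := by
      filter_upwards [eventually_ge_atTop m] with n hn s hs using hImem m n s hn hs
    refine (second_deriv_of_tendsto (by linarith) (w := u) (w' := v) (W := y)
      (g := fun n s => s * u n s + 2 * u n s ^ 3 - a)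
      (H := fun s => s * y s + 2 * y s ^ 3 - a)
      (M := m * (m + a + 4) + 2 * (m + a + 4) ^ 3 + a)
      (hev.mono fun n hn s hs => (hd n s (hn s hs)).1)
      (hev.mono fun n hn s hs => (hd n s (hn s hs)).2)
      ?_ ?_ (fun s _ => hlim s)
      (fun s _ => (((hlim s).const_mul s).add (((hlim s).pow 3).const_mul 2)).sub_const a)
      (fun h => by fun_prop)).2
    · filter_upwards [hev] with n hn
      have : ContinuousOn (u n) (Icc (-(m:ℝ)) m) := (huc n).mono fun s hs =>
        Ioo_subset_Icc_self (hn s hs)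
      fun_prop
    · filter_upwards [hev] with n hn s hs
      have h1 := hpos n s (hn s hs)
      have h2 : u n s ≤ m + a + 4 := by
        have := hbound m n s hs
        simp only [U] at this
        rwa [indicator_of_mem (hn s hs)] at this
      have e1 : u n s ^ 3 ≤ (m + a + 4) ^ 3 := pow_le_pow_left₀ h1.le h2 3
      have e2 : 0 < u n s ^ 3 := pow_pos h1 3
      have e3 : |s * u n s| ≤ m * (m + a + 4) := by
        rw [abs_mul, abs_of_pos h1]
        exact mul_le_mul (abs_le.2 hs) h2 h1.le (by linarith)
      obtain ⟨e4, e5⟩ := abs_le.1 e3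
      refine abs_le.2 ⟨?_, ?_⟩ <;> linarith
  refine ⟨y, deriv y, fun s => ?_, fun s => ?_⟩
  · obtain ⟨m, hm1, hm⟩ := hex s
    obtain ⟨W', hW'⟩ := hloc m hm1
    refine ⟨(hW' s hm).1.differentiableAt.hasDerivAt, (hW' s hm).2.congr_of_eventuallyEq ?_⟩
    filter_upwards [isOpen_Ioo.mem_nhds hm] with t ht using (hW' t ht).1.deriv
  · obtain ⟨m, hm1, hm⟩ := hex s
    have hs := hImem m m s le_rfl (Ioo_subset_Icc_self hm)
    have h1 := hpos m s hs
    have h2 : U m s ≤ y s := le_ciSup (hbdd s) m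
    simp only [U] at h2
    rw [indicator_of_mem hs] at h2
    exact h1.trans_le h2


theorem tendsto_painleve_atBot {y v : ℝ → ℝ} {a : ℝ} (ha : 0 < a)
    (h : ∀ s, HasDerivAt y (v s) s ∧ HasDerivAt v (s * y s + 2 * y s ^ 3 - a) s)
    (hpos : ∀ s, 0 < y s) :
    Tendsto (fun s => y s - Real.sqrt (|s| / 2)) atBot (𝓝 0) := by
  have hyc : Continuous y := continuous_iff_continuousAt.2 fun s => (h s).1.continuousAt
  have hπ : (Real.pi / 2) ^ 2 ≤ 4 := by nlinarith [Real.pi_pos, Real.pi_le_four]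
  have hπ0 := sq_nonneg (Real.pi / 2)
  have hsqrt : Tendsto (fun s : ℝ => Real.sqrt (|s| / 2)) atBot atTop :=
    Real.tendsto_sqrt_atTop.comp (tendsto_abs_atBot_atTop.atTop_div_const two_pos)
  refine squeeze_zero_norm' (a := fun s => (a + 5) / Real.sqrt (|s| / 2)) ?_
    (hsqrt.const_div_atTop _)
  filter_upwards [eventually_le_atBot (-6)] with s hs
  rw [Real.norm_eq_abs, abs_of_nonpos (by linarith : s ≤ 0)]
  have hs2 : 0 < -s / 2 := by linarith
  set r := Real.sqrt (-s / 2)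
  have hr : 0 < r := Real.sqrt_pos.2 hs2
  have hr2 : r ^ 2 = -s / 2 := Real.sq_sqrt hs2.le
  have hup : y s ^ 2 ≤ r ^ 2 + (a + 5) := by
    have hX : 0 ≤ (-s + 1 + a) / 2 + (Real.pi / 2) ^ 2 := by linarith
    have hK2 := Real.sq_sqrt hX
    have := painleve_le_of_window ha hyc.continuousOn (fun t _ => h t) (c := s)
      (K := Real.sqrt ((-s + 1 + a) / 2 + (Real.pi / 2) ^ 2))
      (Real.one_le_sqrt.2 (by linarith)) (by rw [hK2]; linarith) (by rw [hK2]; linarith)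
    have := pow_le_pow_left₀ (hpos s).le this 2
    rw [hK2] at this
    linarith
  have hlo : r ^ 2 - (a + 5) ≤ y s ^ 2 := by
    have hX : 0 < (-s - 1 - (Real.pi / 2) ^ 2) / 2 := by linarith
    have hk := Real.sqrt_pos.2 hX
    have hk2 := Real.sq_sqrt hX.le
    have := le_painleve_of_window ha h hpos hk (c := s)
      (by rw [hk2]; have := div_pos ha hk; linarith)
    have := pow_le_pow_left₀ hk.le this 2
    rw [hk2] at this
    linarith
  rw [le_div_iff₀ hr]
  have hy := hpos s
  calc |y s - r| * r ≤ |y s - r| * (y s + r) := by gcongr; linarith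
    _ = |y s ^ 2 - r ^ 2| := by
      rw [show y s ^ 2 - r ^ 2 = (y s - r) * (y s + r) by ring, abs_mul,
        abs_of_pos (by linarith : 0 < y s + r)]
    _ ≤ a + 5 := abs_le.2 ⟨by linarith, by linarith⟩

theorem tendsto_painleve_atTop {y v : ℝ → ℝ} {a : ℝ} (ha : 0 < a)
    (h : ∀ s, HasDerivAt y (v s) s ∧ HasDerivAt v (s * y s + 2 * y s ^ 3 - a) s)
    (hpos : ∀ s, 0 < y s) :
    Tendsto (fun s => s * y s) atTop (𝓝 a) := by
  have hyc : Continuous y := continuous_iff_continuousAt.2 fun s => (h s).1.continuousAt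
  have hπ : (Real.pi / 2) ^ 2 ≤ 4 := by nlinarith [Real.pi_pos, Real.pi_le_four]
  have hy_le : ∀ s, 0 ≤ s → y s ≤ a + 4 := fun s hs =>
    painleve_le_of_window ha hyc.continuousOn (fun t _ => h t) (by linarith) (by nlinarith)
      (by nlinarith)
  have hinv : Tendsto (fun s : ℝ => s⁻¹) atTop (𝓝 0) := tendsto_inv_atTop_zero
  have hinv' : Tendsto (fun s : ℝ => (Real.sqrt s)⁻¹) atTop (𝓝 0) :=
    hinv.comp Real.tendsto_sqrt_atTop
  obtain ⟨c, hc⟩ : ∃ c, c = 1 + (Real.pi / 2) ^ 2 + 2 * a ^ 2 := ⟨_, rfl⟩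
  have hc0 : 0 ≤ c := by rw [hc]; positivity
  have hlow : Tendsto (fun s : ℝ => a / (1 + c * s⁻¹)) atTop (𝓝 a) := by
    have := (tendsto_const_nhds (x := a)).div ((hinv.const_mul c).const_add 1) (by simp)
    simpa [Pi.div_def] using this
  have hupp : Tendsto (fun s : ℝ => a / (1 - (Real.sqrt s)⁻¹ - 6 * s⁻¹)) atTop (𝓝 a) := by
    have := (tendsto_const_nhds (x := a)).div ((hinv'.const_sub 1).sub (hinv.const_mul 6))
      (by simp)
    simpa [Pi.div_def] using this
  refine tendsto_of_tendsto_of_tendsto_of_le_of_le' hlow hupp ?_ ?_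
  · filter_upwards [eventually_ge_atTop 1] with s hs
    have hsc : 0 < s + c := by linarith
    have hk : 0 < a / (s + c) := div_pos ha hsc
    have hka : a / (s + c) ≤ a := div_le_self ha.le (by linarith)
    have := le_painleve_of_window ha h hpos hk (c := s) (by
      rw [div_div_cancel₀ ha.ne']
      have := pow_le_pow_left₀ hk.le hka 2
      linarith)
    have hs0 : 0 < s := by linarith
    calc a / (1 + c * s⁻¹) = s * (a / (s + c)) := by field_simp
      _ ≤ s * y s := by gcongr
  · filter_upwards [eventually_ge_atTop 16, eventually_ge_atTop (1 + 4 / a)] with s hs16 hsa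
    have hs0 : 0 < s := by linarith
    set R := Real.sqrt s
    have hR : 4 ≤ R := Real.le_sqrt_of_sq_le (by linarith)
    have hR2 : R ^ 2 = s := Real.sq_sqrt hs0.le
    have hd : 0 < s - R - 6 := by nlinarith
    have hκ : 0 < a / (s - R - 6) := div_pos ha hd
    have hends : a + 4 ≤ a / (s - R - 6) * (1 + R ^ 4) := by
      have e1 : a / s ≤ a / (s - R - 6) := by gcongr; linarith
      have e2 : R ^ 4 = s * s := by rw [← hR2]; ring
      have e3 : a + 4 ≤ a * s := by
        have := mul_le_mul_of_nonneg_left hsa ha.le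
        rwa [mul_add, mul_one, mul_div_cancel₀ _ ha.ne'] at this
      calc a + 4 ≤ a * s := e3
        _ = a / s * (s * s) := by field_simp
        _ ≤ a / (s - R - 6) * (1 + R ^ 4) := by
          rw [e2]
          gcongr
          linarith
    have := painleve_le_of_large_window ha h (c := s) (R := R) (by linarith) hκ
      (by rw [div_div_cancel₀ ha.ne'])
      ((hy_le _ (by linarith)).trans hends) ((hy_le _ (by linarith)).trans hends)
    have hR0 : 0 < R := by linarith
    have hsne : s ≠ 0 := hs0.ne'
    have e4 : 1 - R⁻¹ - 6 * s⁻¹ = (s - R - 6) / s := by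
      rw [← hR2]
      field_simp
    calc s * y s ≤ s * (a / (s - R - 6)) := by gcongr
      _ = a / (1 - R⁻¹ - 6 * s⁻¹) := by rw [e4]; field_simp

theorem painleve_antitone {y v : ℝ → ℝ} {a : ℝ} (ha : 0 < a)
    (h : ∀ s, HasDerivAt y (v s) s ∧ HasDerivAt v (s * y s + 2 * y s ^ 3 - a) s)
    (hpos : ∀ s, 0 < y s) : Antitone y := by
  have hyc : Continuous y := continuous_iff_continuousAt.2 fun s => (h s).1.continuousAt
  have hbot := tendsto_painleve_atBot ha h hpos
  have htop := tendsto_painleve_atTop ha h hpos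
  have key : ∀ d, 0 < d → ∀ s, y (s + d) ≤ y s := by
    intro d hd s
    refine le_of_forall_pos_le_add fun η hη => ?_
    obtain ⟨ε, hε, hεη⟩ : ∃ ε, 0 < ε ∧ ε * y s = η :=
      ⟨η / y s, div_pos hη (hpos s), div_mul_cancel₀ _ (hpos s).ne'⟩
    have hsqrt : Tendsto (fun s : ℝ => Real.sqrt (|s| / 2)) atBot atTop :=
      Real.tendsto_sqrt_atTop.comp (tendsto_abs_atBot_atTop.atTop_div_const two_pos)
    have hleft : ∀ᶠ p in atBot, y (p + d) ≤ (1 + ε) * y p := by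
      have h1 : ∀ᶠ p in atBot, |y p - Real.sqrt (|p| / 2)| < ε / 4 := by
        simpa using (Metric.tendsto_nhds.1 hbot (ε / 4) (by positivity))
      have h2 : ∀ᶠ p in atBot, |y (p + d) - Real.sqrt (|p + d| / 2)| < ε / 4 :=
        (tendsto_atBot_add_const_right atBot d tendsto_id).eventually h1
      filter_upwards [h1, h2, hsqrt.eventually_ge_atTop (1 + ε), eventually_le_atBot (-d)]
        with p h3 h4 h5 h6
      have h7 : Real.sqrt (|p + d| / 2) ≤ Real.sqrt (|p| / 2) := by
        apply Real.sqrt_le_sqrt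
        rw [abs_of_nonpos (by linarith), abs_of_nonpos (by linarith)]
        linarith
      have h8 := abs_lt.1 h3
      have h9 := abs_lt.1 h4
      nlinarith
    have hright : ∀ᶠ q in atTop, y (q + d) ≤ (1 + ε) * y q := by
      have h2 : Tendsto (fun q => (q + d) * y (q + d)) atTop (𝓝 a) :=
        htop.comp (tendsto_atTop_add_const_right atTop d tendsto_id)
      have h3 := (h2.sub (htop.const_mul (1 + ε))).eventually
        (gt_mem_nhds (by nlinarith : a - (1 + ε) * a < 0))
      filter_upwards [h3, eventually_gt_atTop 0] with q h4 hq
      have h5 : q * y (q + d) ≤ q * ((1 + ε) * y q) := by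
        nlinarith [mul_pos hd (hpos (q + d))]
      exact le_of_mul_le_mul_left h5 hq
    obtain ⟨p, hp, hps⟩ := (hleft.and (eventually_le_atBot s)).exists
    obtain ⟨q, hq, hqs⟩ := (hright.and (eventually_ge_atTop s)).exists
    have := quotient_le_of_boundary_le (ρ := fun s => y (s + d) / y s) (r := 1 + ε) (p := p) (q := q)
      (u := fun s => y (s + d)) (v := y)
      (ContinuousOn.div (by fun_prop) hyc.continuousOn fun s _ => (hpos s).ne')
      (fun s _ => by rw [div_mul_cancel₀ _ (hpos s).ne'])
      (fun s _ => hpos s)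
      (fun s _ => (h (s + d)).1.comp_add_const s d) (fun s _ => (h (s + d)).2.comp_add_const s d)
      (fun s _ => (h s).1) (fun s _ => (h s).2) (by linarith)
      ((div_le_iff₀ (hpos p)).2 hp) ((div_le_iff₀ (hpos q)).2 hq)
      (fun s _ hlt => by
        have hb := hpos s
        have hb' := hpos (s + d)
        have h1 : 0 < y (s + d) - y s := sub_pos.2 hlt
        have h3 : 0 < 2 * (y (s + d) * y s * ((y (s + d) - y s) * (y (s + d) + y s)))
          + a * (y (s + d) - y s) + d * y (s + d) * y s := by positivity
        linarith) s ⟨hps, hqs⟩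
    rw [div_le_iff₀ (hpos s)] at this
    linarith
  intro s t hst
  rcases hst.eq_or_lt with rfl | hlt
  · exact le_rfl
  · have := key (t - s) (sub_pos.2 hlt) s
    rwa [add_sub_cancel] at this

theorem painleve_deriv_neg {y v : ℝ → ℝ} {a : ℝ} (ha : 0 < a)
    (h : ∀ s, HasDerivAt y (v s) s ∧ HasDerivAt v (s * y s + 2 * y s ^ 3 - a) s)
    (hpos : ∀ s, 0 < y s) (s : ℝ) : v s < 0 := by
  have hv : ∀ s, v s ≤ 0 := fun s => by
    have := (painleve_antitone ha h hpos).deriv_nonpos (x := s)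
    rwa [(h s).1.deriv] at this
  refine lt_of_le_of_ne (hv s) fun h0 => ?_
  have hmax : IsLocalMax v s := Eventually.of_forall fun t => by rw [h0]; exact hv t
  have h1 := second_deriv_nonpos_of_isLocalMax_s8 (Eventually.of_forall fun t => (h t).2)
    ((((hasDerivAt_id s).mul (h s).1).add (((h s).1.pow 3).const_mul 2)).sub_const a) hmax
  simp only [h0, id] at h1
  linarith [hpos s]

/-- Every positive solution of Painlevé II with `α ≤ 0` is minimal. -/
theorem EPII_le_of_pos {y v : ℝ → ℝ} {α : ℝ} (hα : α ≤ 0)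
    (h : ∀ s, HasDerivAt y (v s) s ∧ HasDerivAt v (s * y s + 2 * y s ^ 3 + α) s)
    (hpos : ∀ s, 0 < y s) {φ : ℝ → ℝ} (hφ : ContDiff ℝ 1 φ) (hsupp : HasCompactSupport φ) :
    EPII α y (tsupport φ) ≤ EPII α (fun s => y s + φ s) (tsupport φ) := by
  have hyc : Continuous y := continuous_iff_continuousAt.2 fun s => (h s).1.continuousAt
  have hvc : Continuous v := continuous_iff_continuousAt.2 fun s => (h s).2.continuousAt
  have hφd : ∀ s, HasDerivAt φ (deriv φ s) s := fun s =>
    (hφ.differentiable one_ne_zero s).hasDerivAt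
  have hφc : Continuous φ := hφ.continuous
  have hφ'c : Continuous (deriv φ) := hφ.continuous_deriv le_rfl
  have hφ0 : ∀ s, s ∉ tsupport φ → φ s = 0 := fun s hs => image_eq_zero_of_notMem_tsupport hs
  have hφ'0 : ∀ s, s ∉ tsupport φ → deriv φ s = 0 := fun s hs => by
    by_contra hne
    exact hs (support_deriv_subset hne)
  have hne : ∀ s, y s ≠ 0 := fun s => (hpos s).ne'
  set e₀ : ℝ → ℝ := fun s => (1:ℝ) / 2 * v s ^ 2 + 1 / 2 * s * y s ^ 2 + 1 / 2 * y s ^ 4 + α * y s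
  set e₁ : ℝ → ℝ := fun s => (1:ℝ) / 2 * (v s + deriv φ s) ^ 2 + 1 / 2 * s * (y s + φ s) ^ 2
    + 1 / 2 * (y s + φ s) ^ 4 + α * (y s + φ s)
  have he₀ : EPII α y (tsupport φ) = ∫ s in tsupport φ, e₀ s := by
    simp only [EPII, e₀, fun s => (h s).1.deriv]
  have he₁ : EPII α (fun s => y s + φ s) (tsupport φ) = ∫ s in tsupport φ, e₁ s := by
    simp only [EPII, e₁, fun s => ((h s).1.fun_add (hφd s)).deriv]
  have hc₀ : Continuous e₀ := by fun_prop
  have hc₁ : Continuous e₁ := by fun_prop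
  set Q : ℝ → ℝ := fun s => v s * φ s + 1 / 2 * (φ s ^ 2 * v s / y s)
  set Q' : ℝ → ℝ := fun s => (s * y s + 2 * y s ^ 3 + α) * φ s + v s * deriv φ s
    + 1 / 2 * (((2 * φ s * deriv φ s * v s + φ s ^ 2 * (s * y s + 2 * y s ^ 3 + α)) * y s
      - φ s ^ 2 * v s * v s) / y s ^ 2)
  have hQ : ∀ s, HasDerivAt Q (Q' s) s := fun s => by
    have := ((h s).2.mul (hφd s)).add
      (((((hφd s).pow 2).mul (h s).2).div (h s).1 (hne s)).const_mul (1 / 2))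
    refine this.congr_deriv ?_
    simp [Q']
  have hQc : Continuous Q := continuous_iff_continuousAt.2 fun s => (hQ s).continuousAt
  have hQ'c : Continuous Q' := by
    have hy2 : ∀ s, y s ^ 2 ≠ 0 := fun s => pow_ne_zero 2 (hne s)
    fun_prop (disch := assumption)
  have hQi : Integrable Q := hQc.integrable_of_hasCompactSupport
    (HasCompactSupport.intro hsupp fun s hs => by simp [Q, hφ0 s hs])
  have hQ'i : Integrable Q' := hQ'c.integrable_of_hasCompactSupport
    (HasCompactSupport.intro hsupp fun s hs => by simp [Q', hφ0 s hs, hφ'0 s hs])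
  have hD0 : ∀ s, s ∉ tsupport φ → e₁ s - e₀ s = 0 := fun s hs => by
    simp [e₀, e₁, hφ0 s hs, hφ'0 s hs]
  have hDi : Integrable fun s => e₁ s - e₀ s := (hc₁.sub hc₀).integrable_of_hasCompactSupport
    (HasCompactSupport.intro hsupp hD0)
  have hcomp : IsCompact (tsupport φ) := hsupp
  rw [he₀, he₁, ← sub_nonneg, ← integral_sub (hc₁.continuousOn.integrableOn_compact hcomp)
    (hc₀.continuousOn.integrableOn_compact hcomp),
    setIntegral_eq_integral_of_forall_compl_eq_zero hD0,
    ← integral_eq_zero_of_hasDerivAt_of_integrable hQ hQ'i hQi]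
  refine integral_mono hQ'i hDi fun s => ?_
  have hy := hpos s
  have hid : e₁ s - e₀ s - Q' s = 1 / 2 * (deriv φ s - φ s * v s / y s) ^ 2
      + 1 / 2 * (-α / y s * φ s ^ 2) + 1 / 2 * (φ s ^ 2 * (φ s + 2 * y s) ^ 2) := by
    simp only [e₀, e₁, Q']
    field_simp
    ring
  have h1 : 0 ≤ -α / y s * φ s ^ 2 := mul_nonneg (div_nonneg (by linarith) hy.le) (sq_nonneg _)
  have h2 : 0 ≤ e₁ s - e₀ s - Q' s := by
    rw [hid]
    positivity
  simpa using sub_nonneg.1 h2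

/-- Generalized Hastings–McLeod solutions: for every `α < 0`, Painlevé II has a positive,
strictly decreasing minimal solution with `y(s) ~ |α|/s` at `+∞` and `y(s) ~ √(|s|/2)`
at `-∞`. -/
theorem stmt8 (α : ℝ) (hα : α < 0) :
    ∃ y : ℝ → ℝ, MinimalSol α y ∧ (∀ s : ℝ, 0 < y s) ∧ (∀ s : ℝ, deriv y s < 0) ∧
      Filter.Tendsto (fun s => s * y s) Filter.atTop (𝓝 |α|) ∧
      Filter.Tendsto (fun s => y s - Real.sqrt (|s| / 2)) Filter.atBot (𝓝 0) := by
  have ha : 0 < -α := neg_pos.2 hα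
  obtain ⟨y, v, h, hpos⟩ := exists_pos_painleve ha
  have hv : deriv y = v := funext fun s => (h s).1.deriv
  have hv' : deriv v = fun s => s * y s + 2 * y s ^ 3 + α := funext fun s => by
    rw [(h s).2.deriv, sub_neg_eq_add]
  have hyd : Differentiable ℝ y := fun s => (h s).1.differentiableAt
  have hvd : Differentiable ℝ v := fun s => (h s).2.differentiableAt
  refine ⟨y, ⟨⟨?_, fun s => by rw [hv, hv']⟩, fun φ hφ hsupp => ?_⟩, hpos, fun s => ?_, ?_,
    tendsto_painleve_atBot ha h hpos⟩
  · have hyc := hyd.continuous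
    have hv1 : ContDiff ℝ 1 v := contDiff_one_iff_deriv.2 ⟨hvd, by rw [hv']; fun_prop⟩
    rw [show (2 : WithTop ℕ∞) = 1 + 1 from (one_add_one_eq_two).symm, contDiff_succ_iff_deriv]
    exact ⟨hyd, by simp, by rwa [hv]⟩
  · exact EPII_le_of_pos hα.le (fun s => by simpa only [sub_neg_eq_add] using h s) hpos
      (hφ.of_le (by exact_mod_cast le_top)) hsupp
  · rw [hv]
    exact painleve_deriv_neg ha h hpos s
  · rw [abs_of_neg hα]
    exact tendsto_painleve_atTop ha h hpos
end
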